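/- arXiv:0904.1385 — 4 statements merged into one kernel-verified Lean document; each statement's English description precedes it below -/
import Mathlib

section
/- (Atkinson's oscillation theorem.) Let t₀ ≥ 1, λ > 1, and let q : [t₀,∞) → [0,∞) be continuous with only isolated zeros. Then every solution of the Emden–Fowler equation x''(t) + q(t)·x(t)^λ = 0 that is defined on a neighborhood of +∞ is oscillatory (i.e., has zeros at arbitrarily large t) if and only if ∫_{t₀}^∞ t·q(t) dt = +∞. -/
open Real MeasureTheory Filter Topology Set Asymptotics

/-- The signed power `x^λ := |x|^(λ-1) · x` used in the Emden-Fowler equation. -/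
noncomputable def efPow (lam x : ℝ) : ℝ := |x| ^ (lam - 1) * x

/-- A solution of the Emden-Fowler equation that is positive on a half-line forces `t q(t)` to be
integrable there. -/
lemma integrableOn_of_pos_solution {T lam : ℝ} (hT : 1 ≤ T) (hlam : 1 < lam) {q x x' : ℝ → ℝ}
    (hq_cont : ContinuousOn q (Set.Ici T)) (hq_nonneg : ∀ t ∈ Set.Ici T, 0 ≤ q t)
    (hx : ∀ t ∈ Set.Ici T, HasDerivAt x (x' t) t)
    (hx' : ∀ t ∈ Set.Ici T, HasDerivAt x' (-(q t * efPow lam (x t))) t)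
    (hpos : ∀ t ∈ Set.Ici T, 0 < x t) :
    IntegrableOn (fun t => t * q t) (Set.Ioi T) := by
  have hef : ∀ t ∈ Set.Ici T, efPow lam (x t) = x t ^ lam := fun t ht => by
    rw [efPow, abs_of_pos (hpos t ht), Real.rpow_sub_one (hpos t ht).ne',
      div_mul_cancel₀ _ (hpos t ht).ne']
  have hanti : AntitoneOn x' (Set.Ici T) := by
    refine antitoneOn_of_deriv_nonpos (convex_Ici T)
      (fun t ht => (hx' t ht).continuousAt.continuousWithinAt)
      (fun t ht => (hx' t (interior_subset ht)).differentiableAt.differentiableWithinAt)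
      fun t ht => ?_
    have ht := interior_subset ht
    rw [(hx' t ht).deriv, hef t ht]
    have := mul_nonneg (hq_nonneg t ht) (Real.rpow_nonneg (hpos t ht).le lam)
    linarith
  have hx'_nonneg : ∀ a ∈ Set.Ici T, 0 ≤ x' a := by
    intro a ha
    by_contra! hneg
    have hsub : Set.Ici a ⊆ Set.Ici T := Set.Ici_subset_Ici.2 ha
    have hd : ∀ t ∈ Set.Ici a, HasDerivAt (fun t => x t - x' a * t) (x' t - x' a) t :=
      fun t ht =>
        ((hx t (hsub ht)).sub ((hasDerivAt_id t).const_mul (x' a))).congr_deriv (by simp)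
    have hA : AntitoneOn (fun t => x t - x' a * t) (Set.Ici a) := by
      refine antitoneOn_of_deriv_nonpos (convex_Ici a)
        (fun t ht => (hd t ht).continuousAt.continuousWithinAt)
        (fun t ht => (hd t (interior_subset ht)).differentiableAt.differentiableWithinAt)
        fun t ht => ?_
      have ht := interior_subset ht
      rw [(hd t ht).deriv]
      exact sub_nonpos.2 (hanti ha (hsub ht) ht)
    have hxa := hpos a ha
    have hstep : 0 ≤ x a / (-x' a) := div_nonneg hxa.le (by linarith)
    have hb : a + x a / (-x' a) ∈ Set.Ici a := by simpa using hstep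
    have h1 := hA Set.self_mem_Ici hb hb
    have h2 := hpos _ (hsub hb)
    have h3 : x' a * (x a / (-x' a)) = - x a := by
      rw [div_neg, mul_neg, mul_div_cancel₀ _ hneg.ne]
    simp only [mul_add, h3] at h1
    linarith
  set F : ℝ → ℝ := fun t => t * x' t * x t ^ (-lam) + x t ^ (1 - lam) / (lam - 1) with hF
  set F' : ℝ → ℝ := fun t => -(t * q t) - lam * t * x' t ^ 2 * x t ^ (-lam - 1) with hF'
  have hFd : ∀ t ∈ Set.Ici T, HasDerivAt F (F' t) t := by
    intro t ht
    have hp := hpos t ht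
    have hl : lam - 1 ≠ 0 := by linarith
    have h := (((hasDerivAt_id t).mul (hx' t ht)).mul
      ((hx t ht).rpow_const (p := -lam) (Or.inl hp.ne'))).add
      (((hx t ht).rpow_const (p := 1 - lam) (Or.inl hp.ne')).div_const (lam - 1))
    refine h.congr_deriv ?_
    have e1 : x t ^ lam * x t ^ (-lam) = 1 := by
      rw [← Real.rpow_add hp]; simp
    have e2 : (1 - lam - 1 : ℝ) = -lam := by ring
    rw [hef t ht, e2]
    simp only [hF', id, Pi.mul_apply]
    have e3 : x' t * (1 - lam) * x t ^ (-lam) / (lam - 1) = - (x' t * x t ^ (-lam)) := by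
      field_simp
      ring
    rw [e3]
    linear_combination (- t * q t) * e1
  have hF_nonneg : ∀ t ∈ Set.Ici T, 0 ≤ F t := by
    intro t ht
    have ht0 : 0 ≤ t := by linarith [Set.mem_Ici.1 ht]
    exact add_nonneg (mul_nonneg (mul_nonneg ht0 (hx'_nonneg t ht))
      (Real.rpow_nonneg (hpos t ht).le _))
      (div_nonneg (Real.rpow_nonneg (hpos t ht).le _) (by linarith))
  have hF'_le : ∀ t ∈ Set.Ici T, F' t ≤ -(t * q t) := by
    intro t ht
    have ht0 : 0 ≤ t := by linarith [Set.mem_Ici.1 ht]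
    have : 0 ≤ lam * t * x' t ^ 2 * x t ^ (-lam - 1) :=
      mul_nonneg (mul_nonneg (mul_nonneg (by linarith) ht0) (sq_nonneg _))
        (Real.rpow_nonneg (hpos t ht).le _)
    simp only [hF']
    linarith
  have htq : ∀ t ∈ Set.Ici T, 0 ≤ t * q t := fun t ht =>
    mul_nonneg (by linarith [Set.mem_Ici.1 ht]) (hq_nonneg t ht)
  have hFanti : AntitoneOn F (Set.Ici T) := by
    refine antitoneOn_of_deriv_nonpos (convex_Ici T)
      (fun t ht => (hFd t ht).continuousAt.continuousWithinAt)
      (fun t ht => (hFd t (interior_subset ht)).differentiableAt.differentiableWithinAt)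
      fun t ht => ?_
    have ht := interior_subset ht
    rw [(hFd t ht).deriv]
    linarith [hF'_le t ht, htq t ht]
  have hlim : ∃ l, Tendsto F atTop (𝓝 l) := by
    have hA : Antitone fun t => F (max t T) := fun a b hab =>
      hFanti (le_max_right a T) (le_max_right b T) (max_le_max_right T hab)
    have hB : BddBelow (Set.range fun t => F (max t T)) :=
      ⟨0, by rintro _ ⟨t, rfl⟩; exact hF_nonneg _ (le_max_right t T)⟩
    refine ⟨_, (tendsto_atTop_ciInf hA hB).congr' ?_⟩
    filter_upwards [eventually_ge_atTop T] with t ht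
    rw [max_eq_left ht]
  obtain ⟨l, hl⟩ := hlim
  have hsub : Set.Ioi T ⊆ Set.Ici T := Set.Ioi_subset_Ici_self
  have hintegrable : IntegrableOn F' (Set.Ioi T) :=
    integrableOn_Ioi_deriv_of_nonpos (hFd T Set.self_mem_Ici).continuousAt.continuousWithinAt
      (fun t ht => hFd t (hsub ht))
      (fun t ht => by linarith [hF'_le t (hsub ht), htq t (hsub ht)]) hl
  refine hintegrable.integrable.mono (((continuousOn_id.mul hq_cont).mono hsub).aestronglyMeasurable
    measurableSet_Ioi) ?_
  refine (ae_restrict_mem measurableSet_Ioi).mono fun t ht => ?_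
  have h1 := hF'_le t (hsub ht)
  have h2 := htq t (hsub ht)
  rw [Real.norm_eq_abs, Real.norm_eq_abs, abs_of_nonneg h2, abs_of_nonpos (by linarith)]
  linarith

lemma efPow_neg (lam x : ℝ) : efPow lam (-x) = -efPow lam x := by
  simp [efPow]

/-- The power function `y ^ lam` with its argument truncated to `[0, 1]`. -/
noncomputable def truncPow (lam y : ℝ) : ℝ := max 0 (min y 1) ^ lam

lemma trunc_mem (y : ℝ) : max 0 (min y 1) ∈ Set.Icc (0 : ℝ) 1 :=
  ⟨le_max_left _ _, max_le zero_le_one (min_le_right _ _)⟩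

lemma truncPow_nonneg (lam y : ℝ) : 0 ≤ truncPow lam y :=
  Real.rpow_nonneg (trunc_mem y).1 _

lemma truncPow_le_one {lam : ℝ} (hlam : 1 < lam) (y : ℝ) : truncPow lam y ≤ 1 :=
  Real.rpow_le_one (trunc_mem y).1 (trunc_mem y).2 (by linarith)

lemma continuous_truncPow {lam : ℝ} (hlam : 1 < lam) : Continuous (truncPow lam) :=
  (by fun_prop : Continuous fun y : ℝ => max 0 (min y 1)).rpow_const
    fun _ => Or.inr (by linarith)

lemma abs_truncPow_sub_le {lam : ℝ} (hlam : 1 < lam) (y z : ℝ) :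
    |truncPow lam y - truncPow lam z| ≤ lam * |y - z| := by
  have h1 := Convex.norm_image_sub_le_of_norm_hasDerivWithin_le (𝕜 := ℝ)
    (f := fun y : ℝ => y ^ lam) (f' := fun y => lam * y ^ (lam - 1)) (s := Set.Icc (0 : ℝ) 1)
    (C := lam)
    (fun y _ => (Real.hasDerivAt_rpow_const (Or.inr hlam.le)).hasDerivWithinAt)
    (fun y hy => by
      have h0 := Real.rpow_nonneg hy.1 (lam - 1)
      have h1 := Real.rpow_le_one hy.1 hy.2 (by linarith : 0 ≤ lam - 1)
      rw [Real.norm_eq_abs, abs_of_nonneg (mul_nonneg (by linarith) h0)]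
      nlinarith)
    (convex_Icc 0 1) (trunc_mem z) (trunc_mem y)
  refine h1.trans (mul_le_mul_of_nonneg_left ?_ (by linarith))
  calc ‖max 0 (min y 1) - max 0 (min z 1)‖ ≤ |min y 1 - min z 1| := by
        simpa using abs_max_sub_max_le_max 0 (min y 1) 0 (min z 1)
    _ ≤ |y - z| := by
        simpa using abs_min_sub_min_le_max y 1 z 1

lemma truncPow_eq_efPow (lam : ℝ) {y : ℝ} (h0 : 0 < y) (h1 : y ≤ 1) :
    truncPow lam y = efPow lam y := by
  rw [truncPow, efPow, min_eq_left h1, max_eq_right h0.le, abs_of_pos h0,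
    Real.rpow_sub_one h0.ne', div_mul_cancel₀ _ h0.ne']

lemma tailKernel_nonneg (T s t : ℝ) : 0 ≤ max (s - max t T) 0 := le_max_right _ _

lemma tailKernel_le {T s : ℝ} (hT : 1 ≤ T) (hs : T < s) (t : ℝ) : max (s - max t T) 0 ≤ s :=
  max_le (by linarith [le_max_right t T]) (by linarith)

lemma aestronglyMeasurable_tailKernel_mul {T : ℝ} {h : ℝ → ℝ} (hc : ContinuousOn h (Set.Ici T))
    (t : ℝ) : AEStronglyMeasurable (fun s => max (s - max t T) 0 * h s)
      (volume.restrict (Set.Ioi T)) :=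
  (((by fun_prop : Continuous fun s : ℝ => max (s - max t T) 0).continuousOn.mul hc).mono
    Set.Ioi_subset_Ici_self).aestronglyMeasurable measurableSet_Ioi

lemma norm_tailKernel_mul_le {T s : ℝ} (hT : 1 ≤ T) (hs : T < s) (t y : ℝ) :
    ‖max (s - max t T) 0 * y‖ ≤ ‖s * y‖ := by
  rw [norm_mul, norm_mul, Real.norm_of_nonneg (tailKernel_nonneg T s t),
    Real.norm_of_nonneg (by linarith : 0 ≤ s)]
  exact mul_le_mul_of_nonneg_right (tailKernel_le hT hs t) (norm_nonneg _)

lemma integrable_tailKernel_mul {T : ℝ} (hT : 1 ≤ T) {h : ℝ → ℝ}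
    (hc : ContinuousOn h (Set.Ici T)) (hi : IntegrableOn (fun s => s * h s) (Set.Ioi T)) (t : ℝ) :
    IntegrableOn (fun s => max (s - max t T) 0 * h s) (Set.Ioi T) :=
  hi.integrable.mono (aestronglyMeasurable_tailKernel_mul hc t)
    ((ae_restrict_mem measurableSet_Ioi).mono fun _ hs => norm_tailKernel_mul_le hT hs t _)

lemma continuous_integral_tailKernel_mul {T : ℝ} (hT : 1 ≤ T) {h : ℝ → ℝ}
    (hc : ContinuousOn h (Set.Ici T)) (hi : IntegrableOn (fun s => s * h s) (Set.Ioi T)) :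
    Continuous fun t => ∫ s in Set.Ioi T, max (s - max t T) 0 * h s :=
  continuous_of_dominated (fun t => aestronglyMeasurable_tailKernel_mul hc t)
    (fun t => (ae_restrict_mem measurableSet_Ioi).mono
      fun _ hs => norm_tailKernel_mul_le hT hs t _) hi.norm
    (Eventually.of_forall fun s => by fun_prop)

lemma integrableOn_of_integrableOn_id_mul {T : ℝ} (hT : 1 ≤ T) {h : ℝ → ℝ}
    (hc : ContinuousOn h (Set.Ici T)) (hi : IntegrableOn (fun s => s * h s) (Set.Ioi T)) :
    IntegrableOn h (Set.Ioi T) := by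
  refine hi.integrable.mono ((hc.mono Set.Ioi_subset_Ici_self).aestronglyMeasurable measurableSet_Ioi)
    ((ae_restrict_mem measurableSet_Ioi).mono fun s hs => ?_)
  have hs : T < s := hs
  rw [norm_mul, Real.norm_of_nonneg (by linarith : 0 ≤ s)]
  nlinarith [norm_nonneg (h s)]

lemma hasDerivAt_integral_Ioi {T t : ℝ} {h : ℝ → ℝ} (ht : T < t)
    (hc : ContinuousOn h (Set.Ici T)) (hi : IntegrableOn h (Set.Ioi T)) :
    HasDerivAt (fun t => ∫ s in Set.Ioi t, h s) (-h t) t := by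
  have hc' : ContinuousOn h (Set.Ioi T) := hc.mono Set.Ioi_subset_Ici_self
  have hintegrable : IntervalIntegrable h volume T t := by
    rw [intervalIntegrable_iff_integrableOn_Ioc_of_le ht.le]
    exact hi.mono_set Set.Ioc_subset_Ioi_self
  have h1 := (intervalIntegral.integral_hasDerivAt_right hintegrable
    (hc'.stronglyMeasurableAtFilter isOpen_Ioi t ht)
    (hc'.continuousAt (Ioi_mem_nhds ht))).const_sub (∫ s in Set.Ioi T, h s)
  refine h1.congr_of_eventuallyEq ?_
  filter_upwards [Ioi_mem_nhds ht] with r hr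
  rw [← intervalIntegral.integral_interval_add_Ioi hi
    (hi.mono_set (Set.Ioi_subset_Ioi (le_of_lt hr)))]
  ring

lemma hasDerivAt_integral_tailKernel_mul {T t : ℝ} (hT : 1 ≤ T) (ht : T < t) {h : ℝ → ℝ}
    (hc : ContinuousOn h (Set.Ici T)) (hi : IntegrableOn (fun s => s * h s) (Set.Ioi T)) :
    HasDerivAt (fun t => ∫ s in Set.Ioi T, max (s - max t T) 0 * h s)
      (-∫ s in Set.Ioi t, h s) t := by
  have hh := integrableOn_of_integrableOn_id_mul hT hc hi
  have key := (hasDerivAt_integral_of_dominated_loc_of_lip (μ := volume.restrict (Set.Ioi T))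
    (F := fun t s => max (s - max t T) 0 * h s) (s := Set.univ) (x₀ := t)
    (F' := (Set.Ioi t).indicator fun s => -h s) (bound := h) univ_mem
    (Eventually.of_forall fun r => aestronglyMeasurable_tailKernel_mul hc r)
    (integrable_tailKernel_mul hT hc hi t)
    (hh.neg.aestronglyMeasurable.indicator measurableSet_Ioi)
    (Eventually.of_forall fun s => ?_) hh ?_).2
  · refine key.congr_deriv ?_
    rw [integral_indicator measurableSet_Ioi, Measure.restrict_restrict measurableSet_Ioi,
      Set.inter_eq_left.2 (Set.Ioi_subset_Ioi ht.le), integral_neg]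
  · refine LipschitzOnWith.of_dist_le_mul fun a _ b _ => ?_
    rw [Real.dist_eq, Real.dist_eq, ← sub_mul, abs_mul, mul_comm, Real.coe_nnabs]
    refine mul_le_mul_of_nonneg_left ?_ (abs_nonneg _)
    calc |max (s - max a T) 0 - max (s - max b T) 0| ≤ |(s - max a T) - (s - max b T)| := by
          simpa using abs_max_sub_max_le_max (s - max a T) 0 (s - max b T) 0
      _ = |max b T - max a T| := by congr 1; ring
      _ ≤ |b - a| := by simpa using abs_max_sub_max_le_max b T a T
      _ = |a - b| := abs_sub_comm _ _
  · have hne : ∀ᵐ s ∂(volume.restrict (Set.Ioi T)), s ≠ t := by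
      refine ae_restrict_of_ae ?_
      simp [ae_iff]
    filter_upwards [hne] with s hs
    rcases lt_or_gt_of_ne hs with hlt | hgt
    · rw [Set.indicator_of_notMem (by simpa using hlt.le)]
      refine (hasDerivAt_const t (0 : ℝ)).congr_of_eventuallyEq ?_
      filter_upwards [Ioi_mem_nhds hlt] with r hr
      have hr : s < r := hr
      rw [max_eq_right (by linarith [le_max_left r T]), zero_mul]
    · rw [Set.indicator_of_mem (by simpa using hgt)]
      have h1 : HasDerivAt (fun r => (s - r) * h s) (-h s) t := by
        simpa using ((hasDerivAt_id t).const_sub s).mul_const (h s)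
      refine h1.congr_of_eventuallyEq ?_
      filter_upwards [Ioi_mem_nhds ht, Iio_mem_nhds hgt] with r hr hr'
      have hr : T < r := hr
      have hr' : r < s := hr'
      rw [max_eq_left hr.le, max_eq_left (by linarith)]

lemma continuousOn_mul_truncPow {T lam : ℝ} (hlam : 1 < lam) {q v : ℝ → ℝ}
    (hq_cont : ContinuousOn q (Set.Ici T)) (hv : Continuous v) :
    ContinuousOn (fun s => q s * truncPow lam (v s)) (Set.Ici T) :=
  hq_cont.mul ((continuous_truncPow hlam).comp hv).continuousOn

lemma integrableOn_mul_truncPow {T lam : ℝ} (hlam : 1 < lam) {q v : ℝ → ℝ}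
    (hq_cont : ContinuousOn q (Set.Ici T)) (hv : Continuous v)
    (hi : IntegrableOn (fun s => s * q s) (Set.Ioi T)) :
    IntegrableOn (fun s => s * (q s * truncPow lam (v s))) (Set.Ioi T) := by
  refine hi.integrable.mono (((continuousOn_id.mul (continuousOn_mul_truncPow hlam hq_cont hv)).mono
    Set.Ioi_subset_Ici_self).aestronglyMeasurable measurableSet_Ioi)
    (Eventually.of_forall fun s => ?_)
  rw [← mul_assoc, norm_mul, Real.norm_of_nonneg (truncPow_nonneg _ _)]
  exact mul_le_of_le_one_right (norm_nonneg _) (truncPow_le_one hlam _)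

/-- The integral equation for a solution tending to `1`, solved by the contraction principle. -/
lemma exists_integralEquation_solution {T lam : ℝ} (hT : 1 ≤ T) (hlam : 1 < lam) {q : ℝ → ℝ}
    (hq_cont : ContinuousOn q (Set.Ici T)) (hq_nonneg : ∀ t ∈ Set.Ici T, 0 ≤ q t)
    (hi : IntegrableOn (fun s => s * q s) (Set.Ioi T))
    (hsmall : lam * ∫ s in Set.Ioi T, s * q s ≤ 1 / 2) :
    ∃ u : ℝ → ℝ, Continuous u ∧
      (∀ t, u t = 1 - ∫ s in Set.Ioi T, max (s - max t T) 0 * (q s * truncPow lam (u s))) ∧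
      ∀ t, 1 / 2 ≤ u t ∧ u t ≤ 1 := by
  have hc : ∀ v : ℝ → ℝ, Continuous v → ContinuousOn (fun s => q s * truncPow lam (v s))
    (Set.Ici T) := fun v hv => continuousOn_mul_truncPow hlam hq_cont hv
  have hintegrable : ∀ v : ℝ → ℝ, Continuous v → IntegrableOn
    (fun s => s * (q s * truncPow lam (v s))) (Set.Ioi T) := fun v hv =>
      integrableOn_mul_truncPow hlam hq_cont hv hi
  set J : (ℝ → ℝ) → ℝ → ℝ := fun v t =>
    ∫ s in Set.Ioi T, max (s - max t T) 0 * (q s * truncPow lam (v s)) with hJ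
  have hq : ∀ s ∈ Set.Ioi T, 0 ≤ q s := fun s hs => hq_nonneg s (Set.Ioi_subset_Ici_self hs)
  have hI_nonneg : 0 ≤ ∫ s in Set.Ioi T, s * q s :=
    setIntegral_nonneg measurableSet_Ioi fun s hs =>
      mul_nonneg (by linarith [Set.mem_Ioi.1 hs]) (hq s hs)
  have hJ_nonneg : ∀ v t, 0 ≤ J v t := fun v t =>
    setIntegral_nonneg measurableSet_Ioi fun s hs =>
      mul_nonneg (tailKernel_nonneg T s t) (mul_nonneg (hq s hs) (truncPow_nonneg _ _))
  have hJ_le : ∀ v, Continuous v → ∀ t, J v t ≤ 1 / 2 := by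
    intro v hv t
    have h1 : J v t ≤ ∫ s in Set.Ioi T, s * q s :=
      setIntegral_mono_on (integrable_tailKernel_mul hT (hc v hv) (hintegrable v hv) t) hi
        measurableSet_Ioi fun s hs => mul_le_mul (tailKernel_le hT hs t)
          (mul_le_of_le_one_right (hq s hs) (truncPow_le_one hlam _))
          (mul_nonneg (hq s hs) (truncPow_nonneg _ _)) (by linarith [Set.mem_Ioi.1 hs])
    nlinarith
  have hJ_cont : ∀ v, Continuous v → Continuous (J v) := fun v hv =>
    continuous_integral_tailKernel_mul hT (hc v hv) (hintegrable v hv)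
  let Φ : BoundedContinuousFunction ℝ ℝ → BoundedContinuousFunction ℝ ℝ := fun v =>
    BoundedContinuousFunction.ofNormedAddCommGroup (fun t => 1 - J v t)
      (continuous_const.sub (hJ_cont v v.continuous)) 1 fun t => by
        have h1 := hJ_nonneg v t
        have h2 := hJ_le v v.continuous t
        rw [Real.norm_eq_abs, abs_le]
        constructor <;> linarith
  have hΦ : ContractingWith (1 / 2) Φ := by
    refine ⟨by norm_num, LipschitzWith.of_dist_le_mul fun v w => ?_⟩
    rw [BoundedContinuousFunction.dist_le (by positivity)]
    intro t
    change dist (1 - J v t) (1 - J w t) ≤ _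
    have hbound : ‖J v t - J w t‖ ≤ ∫ s in Set.Ioi T, s * q s * (lam * dist v w) := by
      rw [hJ]
      simp only
      rw [← integral_sub
        (integrable_tailKernel_mul hT (hc v v.continuous) (hintegrable v v.continuous) t)
        (integrable_tailKernel_mul hT (hc w w.continuous) (hintegrable w w.continuous) t)]
      refine norm_integral_le_of_norm_le (hi.mul_const _)
        ((ae_restrict_mem measurableSet_Ioi).mono fun s hs => ?_)
      rw [← mul_sub, ← mul_sub, ← mul_assoc, norm_mul,
        Real.norm_of_nonneg (mul_nonneg (tailKernel_nonneg T s t) (hq s hs))]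
      refine mul_le_mul (mul_le_mul_of_nonneg_right (tailKernel_le hT hs t) (hq s hs)) ?_
        (norm_nonneg _) (mul_nonneg (by linarith [Set.mem_Ioi.1 hs]) (hq s hs))
      refine (abs_truncPow_sub_le hlam _ _).trans (mul_le_mul_of_nonneg_left ?_ (by linarith))
      rw [← Real.dist_eq]
      exact BoundedContinuousFunction.dist_coe_le_dist (f := v) (g := w) s
    rw [integral_mul_const] at hbound
    rw [Real.dist_eq, sub_sub_sub_cancel_left, abs_sub_comm, ← Real.norm_eq_abs]
    refine hbound.trans ?_
    have := mul_le_mul_of_nonneg_right hsmall (dist_nonneg : 0 ≤ dist v w)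
    push_cast
    linarith
  have hfix := hΦ.fixedPoint_isFixedPt
  set u := ContractingWith.fixedPoint Φ hΦ
  have hu : ∀ t, u t = 1 - J u t := fun t => (DFunLike.congr_fun hfix t).symm
  refine ⟨u, u.continuous, hu, fun t => ?_⟩
  have h1 := hJ_nonneg u t
  have h2 := hJ_le u u.continuous t
  rw [hu t]
  constructor <;> linarith

/-- If `t q(t)` is integrable, the Emden-Fowler equation has a solution that is eventually bounded
below by a positive constant. -/
lemma exists_pos_solution {t₀ lam : ℝ} (ht₀ : 1 ≤ t₀) (hlam : 1 < lam) {q : ℝ → ℝ}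
    (hq_cont : ContinuousOn q (Set.Ici t₀)) (hq_nonneg : ∀ t ∈ Set.Ici t₀, 0 ≤ q t)
    (hi : IntegrableOn (fun s => s * q s) (Set.Ici t₀)) :
    ∃ T, t₀ ≤ T ∧ ∃ x x' : ℝ → ℝ, (∀ t ∈ Set.Ici T, HasDerivAt x (x' t) t ∧
      HasDerivAt x' (-(q t * efPow lam (x t))) t) ∧ ∀ t, 1 / 2 ≤ x t := by
  have htail : Tendsto (fun T : ℝ => lam * ∫ s in Set.Ioi T, s * q s) atTop (𝓝 0) := by
    have h := tendsto_setIntegral_of_antitone (μ := volume) (f := fun s => s * q s)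
      (s := fun T : ℝ => Set.Ioi T)
      (fun _ => measurableSet_Ioi) (fun a b hab => Set.Ioi_subset_Ioi hab)
      ⟨t₀, hi.mono_set Set.Ioi_subset_Ici_self⟩
    have hempty : ⋂ T : ℝ, Set.Ioi T = ∅ :=
      Set.eq_empty_of_forall_notMem fun s hs => lt_irrefl s (Set.mem_iInter.1 hs s)
    rw [hempty, setIntegral_empty] at h
    simpa using h.const_mul lam
  obtain ⟨T, hsmall, hT⟩ := ((htail.eventually_le_const (by norm_num : (0 : ℝ) < 1 / 2)).and
    (eventually_ge_atTop t₀)).exists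
  have hT1 : 1 ≤ T := ht₀.trans hT
  have hsub : Set.Ici T ⊆ Set.Ici t₀ := Set.Ici_subset_Ici.2 hT
  have hqc := hq_cont.mono hsub
  have hi' : IntegrableOn (fun s => s * q s) (Set.Ioi T) :=
    hi.mono_set (Set.Ioi_subset_Ici_self.trans hsub)
  obtain ⟨u, hu, hueq, hub⟩ := exists_integralEquation_solution hT1 hlam hqc
    (fun t ht => hq_nonneg t (hsub ht)) hi' hsmall
  have hc := continuousOn_mul_truncPow hlam hqc hu
  have hintegrable := integrableOn_mul_truncPow hlam hqc hu hi'
  refine ⟨T + 1, by linarith, u, fun t => ∫ s in Set.Ioi t, q s * truncPow lam (u s),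
    fun t ht => ?_, fun t => (hub t).1⟩
  have hTt : T < t := by linarith [Set.mem_Ici.1 ht]
  constructor
  · exact (((hasDerivAt_integral_tailKernel_mul hT1 hTt hc hintegrable).const_sub 1).congr_deriv
      (neg_neg _)).congr_of_eventuallyEq (Eventually.of_forall hueq)
  · rw [← truncPow_eq_efPow lam (by linarith [(hub t).1]) (hub t).2]
    exact hasDerivAt_integral_Ioi hTt hc (integrableOn_of_integrableOn_id_mul hT1 hc hintegrable)

/-- **Atkinson's oscillation theorem.** For `t₀ ≥ 1`, `λ > 1` and `q : [t₀,∞) → [0,∞)`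
continuous with only isolated zeros, every solution of `x'' + q(t)·x^λ = 0` defined on a
neighborhood of `+∞` is oscillatory if and only if `∫_{t₀}^∞ t·q(t) dt = +∞`. -/
theorem stmt_0 (t₀ lam : ℝ) (ht₀ : 1 ≤ t₀) (hlam : 1 < lam)
    (q : ℝ → ℝ) (hq_cont : ContinuousOn q (Set.Ici t₀))
    (hq_nonneg : ∀ t ∈ Set.Ici t₀, 0 ≤ q t)
    (hq_iso : ∀ t ∈ Set.Ici t₀, q t = 0 → ∀ᶠ s in 𝓝[≠] t, q s ≠ 0) :
    (∀ T, t₀ ≤ T → ∀ x x' : ℝ → ℝ,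
        (∀ t ∈ Set.Ici T, HasDerivAt x (x' t) t ∧
          HasDerivAt x' (-(q t * efPow lam (x t))) t) →
        ∀ s : ℝ, ∃ t, s ≤ t ∧ x t = 0) ↔
      ¬ IntegrableOn (fun t => t * q t) (Set.Ici t₀) := by
  constructor
  · intro hosc hintegrable
    obtain ⟨T, hT, x, x', hx, hpos⟩ := exists_pos_solution ht₀ hlam hq_cont hq_nonneg hintegrable
    obtain ⟨t, -, h0⟩ := hosc T hT x x' hx T
    linarith [hpos t]
  · intro hnot T hT x x' hx s
    by_contra! hne
    apply hnot
    set S := max s T with hS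
    have htS : t₀ ≤ S := hT.trans (le_max_right _ _)
    have hsub : Set.Ici S ⊆ Set.Ici t₀ := Set.Ici_subset_Ici.2 htS
    have hST : Set.Ici S ⊆ Set.Ici T := Set.Ici_subset_Ici.2 (le_max_right _ _)
    have hne' : ∀ t ∈ Set.Ici S, x t ≠ 0 := fun t ht => hne t ((le_max_left _ _).trans ht)
    have hxc : ContinuousOn x (Set.Ici S) := fun t ht =>
      (hx t (hST ht)).1.continuousAt.continuousWithinAt
    have hIoi : IntegrableOn (fun t => t * q t) (Set.Ioi S) := by
      have hsign : (∀ t ∈ Set.Ici S, 0 < x t) ∨ ∀ t ∈ Set.Ici S, x t < 0 := by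
        by_contra! hcon
        obtain ⟨⟨a, ha, hxa⟩, b, hb, hxb⟩ := hcon
        obtain ⟨c, hc, hxc0⟩ := isPreconnected_Ici.intermediate_value ha hb hxc ⟨hxa, hxb⟩
        exact hne' c hc hxc0
      rcases hsign with hp | hn
      · exact integrableOn_of_pos_solution (ht₀.trans htS) hlam (hq_cont.mono hsub)
          (fun t ht => hq_nonneg t (hsub ht)) (fun t ht => (hx t (hST ht)).1)
          (fun t ht => (hx t (hST ht)).2) hp
      · refine integrableOn_of_pos_solution (x := fun t => -x t) (x' := fun t => -x' t)
          (ht₀.trans htS) hlam (hq_cont.mono hsub)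
          (fun t ht => hq_nonneg t (hsub ht)) (fun t ht => (hx t (hST ht)).1.neg)
          (fun t ht => ?_) fun t ht => neg_pos.2 (hn t ht)
        refine (hx t (hST ht)).2.neg.congr_deriv ?_
        rw [efPow_neg]
        ring
    have hIcc : IntegrableOn (fun t => t * q t) (Set.Icc t₀ S) :=
      ((continuousOn_id.mul hq_cont).mono Set.Icc_subset_Ici_self).integrableOn_Icc
    rw [← Set.Icc_union_Ioi_eq_Ici htS]
    exact hIcc.union hIoi
end

section
/- Let t₀ ≥ 1, λ > 1, and let q : [t₀,∞) → [0,∞) be continuous. If η := λ·∫_{t₀}^∞ t·q(t) dt < 1, then there exists a twice continuously differentiable solution x : [t₀,∞) → ℝ of the Emden–Fowler equation x''(t) + q(t)·x(t)^λ = 0 such that lim_{t→∞} x(t) = 1 and lim_{t→∞} x'(t) = 0. -/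
open Real MeasureTheory Filter Topology Set Asymptotics

theorem efPow_of_nonneg {lam x : ℝ} (hlam : 1 < lam) (hx : 0 ≤ x) : efPow lam x = x ^ lam := by
  rw [efPow, abs_of_nonneg hx]
  nth_rewrite 2 [← rpow_one x]
  rw [← rpow_add' hx (by linarith), sub_add_cancel]

theorem continuous_efPow {lam : ℝ} (hlam : 1 < lam) : Continuous (efPow lam) :=
  (continuous_abs.rpow_const fun _ => Or.inr (by linarith)).mul continuous_id

theorem abs_rpow_sub_rpow_le {lam a b : ℝ} (hlam : 1 < lam) (ha : a ∈ Icc (0 : ℝ) 1)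
    (hb : b ∈ Icc (0 : ℝ) 1) : |a ^ lam - b ^ lam| ≤ lam * |a - b| := by
  refine (convex_Icc (0 : ℝ) 1).norm_image_sub_le_of_norm_hasDerivWithin_le
    (f := fun y : ℝ => y ^ lam) (f' := fun y : ℝ => lam * y ^ (lam - 1))
    (fun y _ => (hasDerivAt_rpow_const (Or.inr hlam.le)).hasDerivWithinAt)
    (fun y hy => ?_) hb ha
  have h0 : 0 ≤ y ^ (lam - 1) := rpow_nonneg hy.1 _
  have h1 : y ^ (lam - 1) ≤ 1 := rpow_le_one hy.1 hy.2 (by linarith)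
  rw [norm_eq_abs, abs_of_nonneg (by nlinarith)]
  nlinarith

theorem abs_clamp_sub_clamp_le (y z : ℝ) :
    |max 0 (min y 1) - max 0 (min z 1)| ≤ |y - z| := by
  rw [max_comm 0, max_comm 0]
  refine (abs_max_sub_max_le_abs _ _ _).trans ?_
  simpa using abs_min_sub_min_le_max y 1 z 1

theorem abs_max_sub_mul_le {t t₀ s g G : ℝ} (ht₀ : 0 ≤ t₀) (ht : t₀ ≤ t) (hs : t₀ < s)
    (hg : |g| ≤ G) : |max (s - t) 0 * g| ≤ s * G := by
  rw [abs_mul, abs_of_nonneg (le_max_right _ _)]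
  exact mul_le_mul (max_le (by linarith) (by linarith)) hg (abs_nonneg _) (by linarith)

/-- A moment-type integral operator with Lipschitz nonlinearity has a fixed point. -/
theorem exists_fixedPoint_moment_integral {t₀ L : ℝ} (ht₀ : 0 ≤ t₀) (hL : 0 ≤ L)
    {Q F : ℝ → ℝ} (hQ : Continuous Q) (hQ0 : ∀ s, 0 ≤ Q s)
    (hint : IntegrableOn (fun s => s * Q s) (Ioi t₀))
    (hF : Continuous F) (hF1 : ∀ y, |F y| ≤ 1) (hFL : ∀ y z, |F y - F z| ≤ L * |y - z|)
    (hη : L * ∫ s in Ioi t₀, s * Q s < 1) :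
    ∃ u : ℝ → ℝ, Continuous u ∧
      ∀ t, t₀ ≤ t → u t = 1 - ∫ s in Ioi t₀, max (s - t) 0 * (Q s * F (u s)) := by
  set M := ∫ s in Ioi t₀, s * Q s with hM
  have hM0 : 0 ≤ M := setIntegral_nonneg measurableSet_Ioi fun s hs =>
    mul_nonneg (ht₀.trans (le_of_lt hs)) (hQ0 s)
  have hQF : ∀ (v : ℝ → ℝ) s, |Q s * F (v s)| ≤ Q s := fun v s => by
    rw [abs_mul, abs_of_nonneg (hQ0 s)]
    exact mul_le_of_le_one_right (hQ0 s) (hF1 _)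
  have hbound : ∀ (v : ℝ → ℝ) (t s : ℝ), s ∈ Ioi t₀ →
      |max (s - max t t₀) 0 * (Q s * F (v s))| ≤ s * Q s := fun v t s hs =>
    abs_max_sub_mul_le ht₀ (le_max_right _ _) hs (hQF v s)
  have hmeas : ∀ (v : ℝ → ℝ) (t : ℝ), Continuous v → AEStronglyMeasurable
      (fun s => max (s - max t t₀) 0 * (Q s * F (v s))) (volume.restrict (Ioi t₀)) :=
    fun v t hv => (by fun_prop : Continuous _).aestronglyMeasurable
  have hI : ∀ (v : ℝ → ℝ) (t : ℝ), Continuous v →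
      IntegrableOn (fun s => max (s - max t t₀) 0 * (Q s * F (v s))) (Ioi t₀) := fun v t hv =>
    hint.mono' (hmeas v t hv) (ae_restrict_of_forall_mem measurableSet_Ioi (hbound v t))
  have hcont : ∀ v : ℝ → ℝ, Continuous v → Continuous fun t =>
      1 - ∫ s in Ioi t₀, max (s - max t t₀) 0 * (Q s * F (v s)) := fun v hv =>
    continuous_const.sub <| continuous_of_dominated (fun t => hmeas v t hv)
      (fun t => ae_restrict_of_forall_mem measurableSet_Ioi (hbound v t)) hint
      (ae_of_all _ fun s => by fun_prop)
  have hle : ∀ (v : ℝ → ℝ) (t : ℝ),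
      ‖1 - ∫ s in Ioi t₀, max (s - max t t₀) 0 * (Q s * F (v s))‖ ≤ 1 + M := fun v t => by
    refine (norm_sub_le _ _).trans (add_le_add (by simp) ?_)
    exact norm_integral_le_of_norm_le hint
      (ae_restrict_of_forall_mem measurableSet_Ioi (hbound v t))
  let T : BoundedContinuousFunction ℝ ℝ → BoundedContinuousFunction ℝ ℝ := fun v =>
    BoundedContinuousFunction.ofNormedAddCommGroup _ (hcont v v.continuous) (1 + M) (hle v)
  have hT : ContractingWith ⟨L * M, mul_nonneg hL hM0⟩ T := by
    refine ⟨hη, LipschitzWith.of_dist_le_mul fun v w => ?_⟩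
    refine (BoundedContinuousFunction.dist_le (mul_nonneg (mul_nonneg hL hM0) dist_nonneg)).2
      fun t => ?_
    change |(1 - ∫ s in Ioi t₀, max (s - max t t₀) 0 * (Q s * F (v s))) -
      (1 - ∫ s in Ioi t₀, max (s - max t t₀) 0 * (Q s * F (w s)))| ≤ L * M * dist v w
    rw [sub_sub_sub_cancel_left, ← integral_sub (hI w t w.continuous) (hI v t v.continuous),
      mul_right_comm, hM, ← integral_const_mul, ← norm_eq_abs]
    refine norm_integral_le_of_norm_le (hint.const_mul _)
      (ae_restrict_of_forall_mem measurableSet_Ioi fun s hs => ?_)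
    rw [← mul_sub, ← mul_sub, norm_eq_abs,
      show L * dist v w * (s * Q s) = s * (Q s * (L * dist v w)) by ring]
    refine abs_max_sub_mul_le ht₀ (le_max_right _ _) hs ?_
    rw [abs_mul, abs_of_nonneg (hQ0 s)]
    refine mul_le_mul_of_nonneg_left ((hFL _ _).trans ?_) (hQ0 s)
    rw [dist_comm, ← Real.dist_eq]
    exact mul_le_mul_of_nonneg_left (BoundedContinuousFunction.dist_coe_le_dist s) hL
  let u := ContractingWith.fixedPoint T hT
  refine ⟨u, u.continuous, fun t ht => ?_⟩
  have hu : T u = u := hT.fixedPoint_isFixedPt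
  have h := congrArg (fun f : BoundedContinuousFunction ℝ ℝ => f t) hu
  change (1 - ∫ s in Ioi t₀, max (s - max t t₀) 0 * (Q s * F (u s))) = u t at h
  rw [← h, max_eq_left ht]

/-- For integrable `g` and `s * g s`, the first moment `∫_t^∞ (s - t) g(s) ds` in terms of
integrals over `(t₀, t)`. -/
theorem integral_max_sub_mul_eq {t₀ t : ℝ} {g : ℝ → ℝ} (ht : t₀ ≤ t)
    (hg : IntegrableOn g (Ioi t₀)) (hsg : IntegrableOn (fun s => s * g s) (Ioi t₀)) :
    ∫ s in Ioi t₀, max (s - t) 0 * g s =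
      ((∫ s in Ioi t₀, s * g s) - ∫ s in t₀..t, s * g s) -
        t * ((∫ s in Ioi t₀, g s) - ∫ s in t₀..t, g s) := by
  have hsub : Ioi t ⊆ Ioi t₀ := Ioi_subset_Ioi ht
  have h1 : ∫ s in Ioi t₀, max (s - t) 0 * g s = ∫ s in Ioi t, max (s - t) 0 * g s :=
    setIntegral_eq_of_subset_of_forall_sdiff_eq_zero measurableSet_Ioi hsub fun s hs => by
      rw [max_eq_right (sub_nonpos.2 (not_lt.1 (mt mem_Ioi.2 hs.2))), zero_mul]
  have h2 : ∫ s in Ioi t, max (s - t) 0 * g s = ∫ s in Ioi t, (s * g s - t * g s) :=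
    setIntegral_congr_fun measurableSet_Ioi fun s hs => by
      simp only [max_eq_left (sub_nonneg.2 (mem_Ioi.1 hs).le), sub_mul]
  rw [h1, h2, integral_sub (hsg.mono_set hsub) ((hg.mono_set hsub).const_mul t),
    integral_const_mul, ← intervalIntegral.integral_interval_add_Ioi hsg (hsg.mono_set hsub),
    ← intervalIntegral.integral_interval_add_Ioi hg (hg.mono_set hsub)]
  ring

theorem tendsto_integral_max_sub_mul {t₀ : ℝ} {g : ℝ → ℝ} (ht₀ : 0 ≤ t₀) (hg : Continuous g)
    (hsg : IntegrableOn (fun s => s * g s) (Ioi t₀)) :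
    Tendsto (fun t => ∫ s in Ioi t₀, max (s - t) 0 * g s) atTop (𝓝 0) := by
  have hbound : IntegrableOn (fun s => s * |g s|) (Ioi t₀) :=
    hsg.norm.congr (ae_restrict_of_forall_mem measurableSet_Ioi fun s hs => by
      simp only [norm_eq_abs, abs_mul, abs_of_nonneg (ht₀.trans (mem_Ioi.1 hs).le)])
  have h := tendsto_integral_filter_of_dominated_convergence (μ := volume.restrict (Ioi t₀))
    (l := atTop) (F := fun t s => max (s - t) 0 * g s) (f := fun _ => 0) (fun s => s * |g s|)
    (Eventually.of_forall fun t => (by fun_prop : Continuous _).aestronglyMeasurable)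
    ((eventually_ge_atTop t₀).mono fun t ht =>
      ae_restrict_of_forall_mem measurableSet_Ioi fun s hs =>
        abs_max_sub_mul_le ht₀ ht hs le_rfl) hbound
    (ae_of_all _ fun s => tendsto_const_nhds.congr' <|
      (eventually_ge_atTop s).mono fun t ht => by
        simp only [max_eq_right (sub_nonpos.2 ht), zero_mul])
  simpa using h

/-- If `η = λ·∫_{t₀}^∞ t·q(t) dt < 1` then the Emden-Fowler equation `x'' + q(t)·x^λ = 0`
has a twice continuously differentiable solution on `[t₀,∞)` with `x(t) → 1` and
`x'(t) → 0` as `t → ∞`. -/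
theorem stmt_1 (t₀ lam : ℝ) (ht₀ : 1 ≤ t₀) (hlam : 1 < lam)
    (q : ℝ → ℝ) (hq_cont : ContinuousOn q (Set.Ici t₀))
    (hq_nonneg : ∀ t ∈ Set.Ici t₀, 0 ≤ q t)
    (hq_int : IntegrableOn (fun t => t * q t) (Set.Ici t₀))
    (hη : lam * ∫ t in Set.Ici t₀, t * q t < 1) :
    ∃ x x' : ℝ → ℝ,
      (∀ t ∈ Set.Ici t₀, HasDerivAt x (x' t) t ∧
        HasDerivAt x' (-(q t * efPow lam (x t))) t) ∧
      ContinuousOn (fun t => -(q t * efPow lam (x t))) (Set.Ici t₀) ∧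
      Tendsto x atTop (𝓝 1) ∧ Tendsto x' atTop (𝓝 0) := by
  have h0 : 0 ≤ t₀ := by linarith
  let Q : ℝ → ℝ := fun s => q (max s t₀)
  have hQq : ∀ s, t₀ ≤ s → Q s = q s := fun s hs => by simp only [Q, max_eq_left hs]
  have hQ : Continuous Q :=
    hq_cont.comp_continuous (by fun_prop) fun s => le_max_right s t₀
  have hQ0 : ∀ s, 0 ≤ Q s := fun s => hq_nonneg _ (le_max_right s t₀)
  have hQint : IntegrableOn (fun s => s * Q s) (Ioi t₀) :=
    (hq_int.mono_set Ioi_subset_Ici_self).congr_fun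
      (fun s hs => by simp only [hQq s (le_of_lt hs)]) measurableSet_Ioi
  have hQη : lam * ∫ s in Ioi t₀, s * Q s < 1 := by
    rw [setIntegral_congr_fun measurableSet_Ioi
      (fun s hs => by simp only [hQq s (le_of_lt hs)] :
        EqOn (fun s => s * Q s) (fun s => s * q s) (Ioi t₀)), ← integral_Ici_eq_integral_Ioi]
    exact hη
  let F : ℝ → ℝ := fun y => efPow lam (max 0 (min y 1))
  have hclamp : ∀ y : ℝ, max 0 (min y 1) ∈ Icc (0 : ℝ) 1 := fun y =>
    ⟨le_max_left _ _, max_le zero_le_one (min_le_right _ _)⟩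
  have hFeq : ∀ y, F y = max 0 (min y 1) ^ lam := fun y => efPow_of_nonneg hlam (hclamp y).1
  have hF : Continuous F := (continuous_efPow hlam).comp (by fun_prop)
  have hF0 : ∀ y, 0 ≤ F y := fun y => (hFeq y).symm ▸ rpow_nonneg (hclamp y).1 _
  have hF1 : ∀ y, F y ≤ 1 := fun y =>
    (hFeq y).symm ▸ rpow_le_one (hclamp y).1 (hclamp y).2 (by linarith)
  have hFL : ∀ y z, |F y - F z| ≤ lam * |y - z| := fun y z => by
    rw [hFeq, hFeq]
    exact (abs_rpow_sub_rpow_le hlam (hclamp y) (hclamp z)).trans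
      (mul_le_mul_of_nonneg_left (abs_clamp_sub_clamp_le y z) (by linarith))
  obtain ⟨u, hu, hfix⟩ := exists_fixedPoint_moment_integral h0 (by linarith : 0 ≤ lam) hQ hQ0
    hQint hF (fun y => by rw [abs_of_nonneg (hF0 y)]; exact hF1 y) hFL hQη
  let g : ℝ → ℝ := fun s => Q s * F (u s)
  have hg : Continuous g := by fun_prop
  have hg0 : ∀ s, 0 ≤ g s := fun s => mul_nonneg (hQ0 s) (hF0 _)
  have hgQ : ∀ s, g s ≤ Q s := fun s => mul_le_of_le_one_right (hQ0 s) (hF1 _)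
  have hsg : IntegrableOn (fun s => s * g s) (Ioi t₀) :=
    hQint.mono' (by fun_prop : Continuous _).aestronglyMeasurable
      (ae_restrict_of_forall_mem measurableSet_Ioi fun s hs => by
        have hs0 : 0 ≤ s := h0.trans (le_of_lt hs)
        rw [norm_eq_abs, abs_of_nonneg (mul_nonneg hs0 (hg0 s))]
        exact mul_le_mul_of_nonneg_left (hgQ s) hs0)
  have hgint : IntegrableOn g (Ioi t₀) :=
    hsg.mono' hg.aestronglyMeasurable
      (ae_restrict_of_forall_mem measurableSet_Ioi fun s hs => by
        rw [norm_eq_abs, abs_of_nonneg (hg0 s)]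
        exact le_mul_of_one_le_left (hg0 s) (ht₀.trans (le_of_lt hs)))
  have hsgc : Continuous fun s => s * g s := by fun_prop
  let x' : ℝ → ℝ := fun t => (∫ s in Ioi t₀, g s) - ∫ s in t₀..t, g s
  let x : ℝ → ℝ := fun t =>
    1 - (((∫ s in Ioi t₀, s * g s) - ∫ s in t₀..t, s * g s) - t * x' t)
  have hxfix : ∀ t, t₀ ≤ t → x t = 1 - ∫ s in Ioi t₀, max (s - t) 0 * g s := fun t ht => by
    rw [integral_max_sub_mul_eq ht hgint hsg]
  have hxu : ∀ t, t₀ ≤ t → x t = u t := fun t ht => by rw [hxfix t ht, hfix t ht]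
  have hx01 : ∀ t, t₀ ≤ t → x t ∈ Icc (0 : ℝ) 1 := fun t ht => by
    have hlow : 0 ≤ ∫ s in Ioi t₀, max (s - t) 0 * g s :=
      integral_nonneg fun s => mul_nonneg (le_max_right _ _) (hg0 s)
    have hupp : |∫ s in Ioi t₀, max (s - t) 0 * g s| ≤ ∫ s in Ioi t₀, s * Q s := by
      rw [← norm_eq_abs]
      exact norm_integral_le_of_norm_le hQint
        (ae_restrict_of_forall_mem measurableSet_Ioi fun s hs =>
          abs_max_sub_mul_le h0 ht hs ((abs_of_nonneg (hg0 s)).trans_le (hgQ s)))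
    have hM : 0 ≤ ∫ s in Ioi t₀, s * Q s := (abs_nonneg _).trans hupp
    rw [abs_of_nonneg hlow] at hupp
    rw [hxfix t ht]
    constructor <;> nlinarith
  have hgx : ∀ t, t₀ ≤ t → g t = q t * efPow lam (x t) := fun t ht => by
    have hx := hx01 t ht
    simp only [g, F, ← hxu t ht, hQq t ht, min_eq_left hx.2, max_eq_right hx.1]
  have hx' : ∀ t, HasDerivAt x' (-g t) t := fun t =>
    (intervalIntegral.integral_hasDerivAt_right (hg.intervalIntegrable _ _)
      (hg.stronglyMeasurableAtFilter _ _) hg.continuousAt).const_sub _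
  have hx : ∀ t, HasDerivAt x (x' t) t := fun t => by
    have h := (((intervalIntegral.integral_hasDerivAt_right (hsgc.intervalIntegrable t₀ t)
      (hsgc.stronglyMeasurableAtFilter _ _) hsgc.continuousAt).const_sub
        (∫ s in Ioi t₀, s * g s)).sub ((hasDerivAt_id t).mul (hx' t))).const_sub 1
    have hslope : -(-(t * g t) - (1 * x' t + id t * -g t)) = x' t := by
      rw [id]
      ring
    exact hslope ▸ h
  refine ⟨x, x', fun t ht => ⟨hx t, hgx t ht ▸ hx' t⟩,
    hg.neg.continuousOn.congr fun t ht => by rw [← hgx t ht]; rfl, ?_, ?_⟩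
  · have h := (tendsto_integral_max_sub_mul h0 hg hsg).const_sub 1
    rw [sub_zero] at h
    exact h.congr' ((eventually_ge_atTop t₀).mono fun t ht => (hxfix t ht).symm)
  · have h := (intervalIntegral_tendsto_integral_Ioi t₀ hgint tendsto_id).const_sub
      (∫ s in Ioi t₀, g s)
    rw [sub_self] at h
    exact h
end

section
/- (Hale–Onuchic, Theorem 1.) Assume ∫_{t₀}^∞ K(s) ds ≤ s₀·M and that t^r·|R(t,z)| ≤ K(t) for every z ∈ Z_M and every t ≥ t₀. Then there exists a continuously differentiable z = (z₁,…,z_{r+1}) ∈ Z_M satisfying the integro-differential system z_i'(t) = (−1)^{r+1−i} · t^{r+1−i}/(r+1−i)! · R(t,z) for all 1 ≤ i ≤ r+1 and all t ≥ t₀. -/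
open Real MeasureTheory Filter Topology Set Asymptotics

noncomputable section

/-- `Q_p(t,x) = Σ_{j=1}^{k-p} a_j (t-t₀)^{k-p-j}/(k-p-j)! + ∫_{t₀}^t (t-s)^{k-p-1}/(k-p-1)! x(s) ds`. -/
def QpHO (t₀ : ℝ) (k : ℕ) (a : ℕ → ℝ) (p : ℕ) (x : ℝ → ℝ) (t : ℝ) : ℝ :=
  (∑ j ∈ Finset.Icc 1 (k - p), a j * (t - t₀) ^ (k - p - j) / (Nat.factorial (k - p - j))) +
    ∫ s in t₀..t, (t - s) ^ (k - p - 1) / (Nat.factorial (k - p - 1)) * x s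

/-- `x_z(t) = Σ_{q=1}^{r+1} t^{q-1}/(q-1)! z_q(t)`. -/
def xzHO (r : ℕ) (z : ℕ → ℝ → ℝ) (t : ℝ) : ℝ :=
  ∑ q ∈ Finset.Icc 1 (r + 1), t ^ (q - 1) / (Nat.factorial (q - 1)) * z q t

/-- `S_d(t) = Σ_{l=d}^{r+1} t^{l-d}/(l-d)! z_l(t)`. -/
def SdHO (r : ℕ) (z : ℕ → ℝ → ℝ) (d : ℕ) (t : ℝ) : ℝ :=
  ∑ l ∈ Finset.Icc d (r + 1), t ^ (l - d) / (Nat.factorial (l - d)) * z l t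

/-- `R(t,z) = P(t, Q₀(t,x_z),…,Q_{k-1}(t,x_z), S₁(t),…,S_{r+1}(t))`. -/
def RHO (t₀ : ℝ) (k r : ℕ) (a : ℕ → ℝ) (P : ℝ → (Fin (k + r + 1) → ℝ) → ℝ)
    (z : ℕ → ℝ → ℝ) (t : ℝ) : ℝ :=
  P t (fun i => if i.1 < k then QpHO t₀ k a i.1 (xzHO r z) t else SdHO r z (i.1 - k + 1) t)

/-- Membership in the Hale–Onuchic set `Z_M`. -/
def ZM (t₀ c : ℝ) (r : ℕ) (s : ℕ → ℝ) (K : ℝ → ℝ) (z : ℕ → ℝ → ℝ) : Prop :=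
  (∀ i ∈ Finset.Icc 1 (r + 1), ContinuousOn (z i) (Set.Ici t₀)) ∧
    (∀ t ∈ Set.Ici t₀, |z 1 t - c| ≤ s 1 / s 0 * ∫ τ in Set.Ioi t, K τ) ∧
    ∀ i ∈ Finset.Icc 2 (r + 1), ∀ t ∈ Set.Ici t₀,
      |z i t| ≤ s i / s 0 * ∫ τ in Set.Ioi t, K τ / τ ^ (i - 1)

/-! ### Brouwer's fixed point theorem -/

section Brouwer

open Metric

variable {E : Type*} [NormedAddCommGroup E] [InnerProductSpace ℝ E] [FiniteDimensional ℝ E]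

/-- The polynomial `t ↦ det (1 + t A)` is determined by its values at `finrank E + 1` nodes. -/
lemma exists_weights_det_one_add {v : ℕ → ℝ} (hv : Function.Injective v) :
    ∃ w : ℕ → ℝ, ∀ A : E →L[ℝ] E,
      (1 + A).det = ∑ j ∈ Finset.range (Module.finrank ℝ E + 1), w j * (1 + v j • A).det := by
  set s := Finset.range (Module.finrank ℝ E + 1)
  refine ⟨fun j => (Lagrange.basis s v j).eval 1, fun A => ?_⟩
  let b := Module.finBasis ℝ E
  let B := LinearMap.toMatrix b b (A : E →ₗ[ℝ] E)
  let p : Polynomial ℝ := Matrix.det ((Polynomial.X : Polynomial ℝ) • B.map Polynomial.C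
    + (1 : Matrix (Fin (Module.finrank ℝ E)) (Fin (Module.finrank ℝ E)) ℝ).map Polynomial.C)
  have hp : ∀ t : ℝ, p.eval t = (1 + t • A).det := by
    intro t
    have h1 : (1 + t • A).det = Matrix.det (1 + t • B) := by
      change LinearMap.det ((1 + t • A : E →L[ℝ] E) : E →ₗ[ℝ] E) = _
      rw [← LinearMap.det_toMatrix b]
      congr 1
      have : ((1 + t • A : E →L[ℝ] E) : E →ₗ[ℝ] E) = LinearMap.id + t • (A : E →ₗ[ℝ] E) := by
        ext; simp
      rw [this, map_add, map_smul, LinearMap.toMatrix_id]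
    rw [h1]
    refine (RingHom.map_det (Polynomial.evalRingHom t) _).trans (congrArg Matrix.det ?_)
    ext i j
    by_cases h : i = j <;> simp [h] <;> ring
  have hdeg : p.degree < s.card := by
    refine lt_of_le_of_lt Polynomial.degree_le_natDegree ?_
    have := Polynomial.natDegree_det_X_add_C_le B 1
    rw [Fintype.card_fin] at this
    rw [Finset.card_range]
    exact_mod_cast Nat.lt_succ_of_le this
  have h := Lagrange.eq_interpolate (hv.injOn) hdeg
  have h1 := hp 1
  rw [one_smul, h, Lagrange.interpolate_apply, Polynomial.eval_finsetSum] at h1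
  rw [← h1]
  refine Finset.sum_congr rfl fun j _ => ?_
  rw [Polynomial.eval_mul, Polynomial.eval_C, hp, mul_comm]

lemma det_one_add_smul_pos {A : E →L[ℝ] E} {t : ℝ} (ht : 0 ≤ t) (hA : t * ‖A‖ < 1) :
    0 < (1 + t • A).det := by
  by_contra! hneg
  have hcont : ContinuousOn (fun s : ℝ => (1 + s • A).det) (Icc 0 t) := by
    apply Continuous.continuousOn
    exact ContinuousLinearMap.continuous_det.comp (by fun_prop)
  have h0 : (1 + (0 : ℝ) • A).det = 1 := by
    rw [zero_smul, add_zero]; exact LinearMap.det_id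
  obtain ⟨s, hs, hs0⟩ := intermediate_value_Icc' ht hcont
    (show (0 : ℝ) ∈ _ from ⟨hneg, by simp only [h0]; norm_num⟩)
  obtain ⟨v, hv, hv0⟩ := Submodule.exists_mem_ne_zero_of_ne_bot
    (LinearMap.bot_lt_ker_of_det_eq_zero hs0).ne'
  have hv1 : v + s • A v = 0 := by simpa using hv
  have hn : ‖v‖ ≤ s * (‖A‖ * ‖v‖) := by
    conv_lhs =>
      rw [eq_neg_of_add_eq_zero_left hv1, norm_neg, norm_smul, Real.norm_of_nonneg hs.1]
    exact mul_le_mul_of_nonneg_left (A.le_opNorm v) hs.1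
  have hvp : 0 < ‖v‖ := norm_pos_iff.2 hv0
  have : s * ‖A‖ ≤ t * ‖A‖ := mul_le_mul_of_nonneg_right hs.2 (norm_nonneg _)
  nlinarith

lemma det_fderiv_eq_zero_of_norm_eq_one {f : E → E} {f' : E →L[ℝ] E} {x : E}
    (hf : HasFDerivAt f f' x) (h1 : ∀ᶠ y in 𝓝 x, ‖f y‖ = 1) : f'.det = 0 := by
  by_contra hdet
  have h2 : HasFDerivAt (fun y => ‖f y‖ ^ 2) (0 : E →L[ℝ] ℝ) x := by
    refine (hasFDerivAt_const (1 : ℝ) x).congr_of_eventuallyEq ?_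
    filter_upwards [h1] with y hy
    rw [hy, one_pow]
  have h3 := hf.norm_sq.unique h2
  obtain ⟨v, hv⟩ := (LinearMap.equivOfDetNeZero (f' : E →ₗ[ℝ] E) hdet).surjective (f x)
  have hv' : f' v = f x := hv
  have h4 := congrArg (fun L : E →L[ℝ] ℝ => L v) h3
  simp [hv', h1.self_of_nhds] at h4

/-- There is no `C¹` retraction of the unit ball onto the unit sphere. -/
lemma not_exists_contDiff_retraction {g : E → E}
    (hg : ∀ x ∈ closedBall (0 : E) 1, ContDiffAt ℝ 1 g x) (h0 : ∀ x, ‖x‖ = 1 → g x = 0)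
    (h1 : ∀ x ∈ closedBall (0 : E) 1, ‖x + g x‖ = 1) : False := by
  have hfd : ContinuousOn (fderiv ℝ g) (closedBall 0 1) := fun x hx =>
    ((hg x hx).continuousAt_fderiv (by norm_num)).continuousWithinAt
  obtain ⟨C, hC⟩ := (isCompact_closedBall (0 : E) 1).exists_bound_of_continuousOn hfd
  have hC0 : 0 ≤ C := (norm_nonneg _).trans (hC 0 (by simp))
  have hdiff : ∀ x ∈ closedBall (0 : E) 1, DifferentiableAt ℝ g x := fun x hx =>
    (hg x hx).differentiableAt (by norm_num)
  have hlip : ∀ x ∈ closedBall (0 : E) 1, ∀ y ∈ closedBall (0 : E) 1,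
      ‖g x - g y‖ ≤ C * ‖x - y‖ := fun x hx y hy =>
    (convex_closedBall (0 : E) 1).norm_image_sub_le_of_norm_fderiv_le hdiff hC hy hx
  classical
  let G : E → E := (closedBall (0 : E) 1).indicator g
  have hGin : ∀ x ∈ closedBall (0 : E) 1, G x = g x := fun x hx => indicator_of_mem hx g
  have hGout : ∀ x, x ∉ ball (0 : E) 1 → G x = 0 := by
    intro x hx
    by_cases h : x ∈ closedBall (0 : E) 1
    · rw [hGin x h]
      refine h0 x (le_antisymm (by simpa using h) (by simpa using hx))
    · exact indicator_of_notMem h g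
  have hcross : ∀ x ∈ closedBall (0 : E) 1, ∀ y, y ∉ closedBall (0 : E) 1 →
      ‖G x - G y‖ ≤ C * ‖x - y‖ := by
    intro x hx y hy
    have hcont : ContinuousOn (fun s : ℝ => ‖x + s • (y - x)‖) (Icc 0 1) := by fun_prop
    obtain ⟨s, hs, hs1⟩ := intermediate_value_Icc zero_le_one hcont
      (show (1 : ℝ) ∈ _ from ⟨by simpa using hx, by
        simp only [mem_closedBall, dist_zero_right, not_le] at hy; simpa using hy.le⟩)
    have hs1 : ‖x + s • (y - x)‖ = 1 := hs1
    have := hlip x hx (x + s • (y - x)) (by simp [hs1])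
    rw [h0 _ hs1, ← hGin x hx] at this
    rw [hGout y (fun h => hy (ball_subset_closedBall h))]
    refine this.trans (mul_le_mul_of_nonneg_left ?_ hC0)
    rw [show x - (x + s • (y - x)) = s • (x - y) by rw [← neg_sub y x, smul_neg]; abel,
      norm_smul, Real.norm_of_nonneg hs.1]
    nlinarith [norm_nonneg (x - y), hs.2]
  have hGlip : ∀ x y, ‖G x - G y‖ ≤ C * ‖x - y‖ := by
    intro x y
    by_cases hx : x ∈ closedBall (0 : E) 1 <;> by_cases hy : y ∈ closedBall (0 : E) 1
    · rw [hGin x hx, hGin y hy]; exact hlip x hx y hy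
    · exact hcross x hx y hy
    · rw [norm_sub_rev, norm_sub_rev x]; exact hcross y hy x hx
    · rw [hGout x (fun h => hx (ball_subset_closedBall h)),
        hGout y (fun h => hy (ball_subset_closedBall h))]
      simpa using mul_nonneg hC0 (norm_nonneg _)
  -- for small `t`, the map `x ↦ x + t G x` is a bijection preserving the ball
  have himage : ∀ t : ℝ, 0 ≤ t → t * C < 1 →
      InjOn (fun x => x + t • g x) (ball (0 : E) 1) ∧
        (fun x => x + t • g x) '' ball (0 : E) 1 = ball 0 1 := by
    intro t ht htC
    let F : E → E := fun x => x + t • G x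
    have happ : ApproximatesLinearOn F ((ContinuousLinearEquiv.refl ℝ E : E ≃L[ℝ] E) : E →L[ℝ] E)
        univ ⟨t * C, mul_nonneg ht hC0⟩ := by
      intro x _ y _
      have : F x - F y - (x - y) = t • (G x - G y) := by
        simp only [F, smul_sub]; abel
      change ‖F x - F y - (x - y)‖ ≤ t * C * ‖x - y‖
      rw [this, norm_smul, Real.norm_of_nonneg ht, mul_assoc]
      exact mul_le_mul_of_nonneg_left (hGlip x y) ht
    have hinj : Function.Injective F := by
      intro x y hxy
      by_contra hne
      have hp : 0 < ‖x - y‖ := norm_pos_iff.2 (sub_ne_zero.2 hne)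
      have : x - y = - (t • (G x - G y)) := by
        have hxy : x + t • G x = y + t • G y := hxy
        rw [smul_sub, neg_sub, sub_eq_sub_iff_add_eq_add, hxy, add_comm]
      have h2 : ‖x - y‖ ≤ t * (C * ‖x - y‖) := by
        conv_lhs => rw [this, norm_neg, norm_smul, Real.norm_of_nonneg ht]
        exact mul_le_mul_of_nonneg_left (hGlip x y) ht
      nlinarith
    have hsurj : Function.Surjective F := by
      rcases subsingleton_or_nontrivial E with hE | hE
      · exact happ.surjective (Or.inl hE)
      · refine happ.surjective (Or.inr ?_)
        have : ‖((ContinuousLinearEquiv.refl ℝ E).symm : E →L[ℝ] E)‖₊ = 1 := by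
          have := ContinuousLinearMap.norm_id (𝕜 := ℝ) (E := E)
          exact NNReal.eq this
        rw [this, inv_one]
        exact htC
    have hFg : EqOn F (fun x => x + t • g x) (ball 0 1) := fun x hx => by
      simp only [F]; rw [hGin x (ball_subset_closedBall hx)]
    have hFout : ∀ x, x ∉ ball (0 : E) 1 → F x = x := fun x hx => by
      simp only [F]; rw [hGout x hx, smul_zero, add_zero]
    refine ⟨hinj.injOn.congr hFg, ?_⟩
    rw [← hFg.image_eq]
    ext y
    constructor
    · rintro ⟨x, hx, rfl⟩
      by_contra hy
      exact hy (by rwa [hinj (hFout _ hy)])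
    · intro hy
      obtain ⟨x, rfl⟩ := hsurj y
      refine ⟨x, ?_, rfl⟩
      by_contra hx
      rw [hFout x hx] at hy
      exact hx hy
  borelize E
  let μ : Measure E := Measure.addHaar
  have hfdint : ∀ t : ℝ, IntegrableOn (fun x => (1 + t • fderiv ℝ g x).det) (ball 0 1) μ := by
    intro t
    refine IntegrableOn.mono_set (ContinuousOn.integrableOn_compact
      (isCompact_closedBall (0 : E) 1) ?_) ball_subset_closedBall
    exact ContinuousLinearMap.continuous_det.comp_continuousOn
      (continuousOn_const.add (hfd.const_smul t))
  have hvol : ∀ t : ℝ, 0 ≤ t → t * C < 1 →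
      ∫ x in ball (0 : E) 1, (1 + t • fderiv ℝ g x).det ∂μ = μ.real (ball 0 1) := by
    intro t ht htC
    obtain ⟨hinj, him⟩ := himage t ht htC
    have hder : ∀ x ∈ ball (0 : E) 1, HasFDerivWithinAt (fun x => x + t • g x)
        (1 + t • fderiv ℝ g x) (ball 0 1) x := fun x hx =>
      ((hasFDerivAt_id x).add ((hdiff x (ball_subset_closedBall hx)).hasFDerivAt.const_smul
        t)).hasFDerivWithinAt
    have := integral_image_eq_integral_abs_det_fderiv_smul μ measurableSet_ball hder hinj
      (fun _ => (1 : ℝ))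
    rw [him] at this
    simp only [smul_eq_mul, mul_one, setIntegral_const] at this
    rw [this]
    refine setIntegral_congr_fun measurableSet_ball fun x hx => ?_
    refine (abs_of_pos (det_one_add_smul_pos ht (lt_of_le_of_lt ?_ htC))).symm
    exact mul_le_mul_of_nonneg_left (hC x (ball_subset_closedBall hx)) ht
  have hvC : 0 < C + 1 := by linarith
  let v : ℕ → ℝ := fun j => 1 / ((C + 1) * (j + 1))
  have hv0 : ∀ j, 0 ≤ v j := fun j => by positivity
  have hv1 : ∀ j, v j * C < 1 := by
    intro j
    have : (0 : ℝ) ≤ j := j.cast_nonneg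
    simp only [v]
    rw [div_mul_eq_mul_div, one_mul, div_lt_one (by positivity)]
    nlinarith
  have hvinj : Function.Injective v := by
    intro i j hij
    simp only [v, one_div, inv_inj] at hij
    have := mul_left_cancel₀ hvC.ne' hij
    exact_mod_cast add_right_cancel this
  obtain ⟨w, hw⟩ := exists_weights_det_one_add (E := E) hvinj
  have hw1 : ∑ j ∈ Finset.range (Module.finrank ℝ E + 1), w j = 1 := by
    have h := hw 0
    have hone : (1 : E →L[ℝ] E).det = 1 := LinearMap.det_id
    simp only [smul_zero, add_zero, hone, mul_one] at h
    exact h.symm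
  have hzero : ∀ x ∈ ball (0 : E) 1, (1 + fderiv ℝ g x).det = 0 := by
    intro x hx
    refine det_fderiv_eq_zero_of_norm_eq_one (f := fun x => x + g x) (x := x) ?_ ?_
    · exact (hasFDerivAt_id x).add (hdiff x (ball_subset_closedBall hx)).hasFDerivAt
    · filter_upwards [isOpen_ball.mem_nhds hx] with y hy
      exact h1 y (ball_subset_closedBall hy)
  have hfinal : ∫ x in ball (0 : E) 1, (1 + fderiv ℝ g x).det ∂μ = μ.real (ball 0 1) := by
    rw [integral_congr_ae (.of_forall fun x => hw (fderiv ℝ g x)),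
      integral_finsetSum _ fun j _ => (hfdint (v j)).const_mul (w j)]
    simp_rw [integral_const_mul]
    rw [Finset.sum_congr rfl fun j _ => by rw [hvol (v j) (hv0 j) (hv1 j)], ← Finset.sum_mul, hw1,
      one_mul]
  rw [setIntegral_congr_fun measurableSet_ball hzero, integral_zero] at hfinal
  have : 0 < μ.real (ball (0 : E) 1) :=
    ENNReal.toReal_pos (measure_ball_pos μ 0 one_pos).ne' measure_ball_lt_top.ne
  exact this.ne hfinal

omit [FiniteDimensional ℝ E] in
lemma norm_add_smul_eq_one {x u : E} {l : ℝ} (hu : u ≠ 0)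
    (hD : 0 ≤ inner ℝ x u ^ 2 + ‖u‖ ^ 2 * (1 - ‖x‖ ^ 2))
    (hl : l = (-inner ℝ x u + √(inner ℝ x u ^ 2 + ‖u‖ ^ 2 * (1 - ‖x‖ ^ 2))) / ‖u‖ ^ 2) :
    ‖x + l • u‖ = 1 := by
  have ha : ‖u‖ ^ 2 ≠ 0 := by positivity
  have hs := Real.sq_sqrt hD
  set D := inner ℝ x u ^ 2 + ‖u‖ ^ 2 * (1 - ‖x‖ ^ 2) with hDdef
  have h1 : l * ‖u‖ ^ 2 = -inner ℝ x u + √D := by rw [hl]; field_simp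
  have h2 : ‖x + l • u‖ ^ 2 = 1 := by
    rw [norm_add_sq_real, norm_smul, real_inner_smul_right, mul_pow, Real.norm_eq_abs, sq_abs]
    have h3 : (l * ‖u‖ ^ 2 + inner ℝ x u) ^ 2 = inner ℝ x u ^ 2 + ‖u‖ ^ 2 * (1 - ‖x‖ ^ 2) := by
      rw [h1, ← hDdef]; linear_combination hs
    have h4 : ‖u‖ ^ 2 * (‖x‖ ^ 2 + 2 * (l * inner ℝ x u) + l ^ 2 * ‖u‖ ^ 2 - 1) = 0 := by
      linear_combination h3
    linarith [(mul_eq_zero.1 h4).resolve_left ha]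
  nlinarith [norm_nonneg (x + l • u)]

/-- Brouwer's theorem for `C¹` maps sending the closed unit ball to the open unit ball. -/
lemma exists_isFixedPt_of_contDiff {p : E → E} (hp : ContDiff ℝ 1 p)
    (hb : ∀ x ∈ closedBall (0 : E) 1, ‖p x‖ < 1) :
    ∃ x ∈ closedBall (0 : E) 1, Function.IsFixedPt p x := by
  by_contra! hne
  have hu : ∀ x ∈ closedBall (0 : E) 1, x - p x ≠ 0 := fun x hx h =>
    hne x hx (sub_eq_zero.1 h).symm
  let D : E → ℝ := fun x => inner ℝ x (x - p x) ^ 2 + ‖x - p x‖ ^ 2 * (1 - ‖x‖ ^ 2)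
  let l : E → ℝ := fun x => (-inner ℝ x (x - p x) + √(D x)) / ‖x - p x‖ ^ 2
  have hbpos : ∀ x : E, ‖x‖ = 1 → 0 < inner ℝ x (x - p x) := by
    intro x hx
    have h1 := real_inner_le_norm x (p x)
    have h2 := hb x (by simp [hx])
    rw [inner_sub_right, real_inner_self_eq_norm_sq, hx]
    rw [hx] at h1
    linarith
  have hD : ∀ x ∈ closedBall (0 : E) 1, 0 < D x := by
    intro x hx
    have hx1 : ‖x‖ ≤ 1 := by simpa using hx
    have hup : 0 < ‖x - p x‖ ^ 2 := by have := norm_pos_iff.2 (hu x hx); positivity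
    rcases hx1.lt_or_eq with h | h
    · have : 0 < 1 - ‖x‖ ^ 2 := by nlinarith [norm_nonneg x]
      have := mul_pos hup this
      simp only [D]
      nlinarith [sq_nonneg (inner ℝ x (x - p x))]
    · have := hbpos x h
      simp only [D, h]
      nlinarith
  refine not_exists_contDiff_retraction (g := fun x => l x • (x - p x)) ?_ ?_ ?_
  · intro x hx
    have hi : ContDiffAt ℝ 1 (fun x => x - p x) x := contDiffAt_id.sub hp.contDiffAt
    have hin : ContDiffAt ℝ 1 (fun x => inner ℝ x (x - p x)) x := contDiffAt_id.inner ℝ hi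
    have hDc : ContDiffAt ℝ 1 D x :=
      (hin.pow 2).add ((hi.norm_sq ℝ).mul (contDiffAt_const.sub (contDiffAt_id.norm_sq ℝ)))
    refine ContDiffAt.smul (ContDiffAt.div (hin.neg.add (hDc.sqrt (hD x hx).ne'))
      (hi.norm_sq ℝ) ?_) hi
    have := norm_pos_iff.2 (hu x hx)
    positivity
  · intro x hx
    have := hbpos x hx
    simp [l, D, hx, Real.sqrt_sq this.le]
  · intro x hx
    exact norm_add_smul_eq_one (hu x hx) (hD x hx).le rfl

/-- **Brouwer's fixed point theorem** for continuous maps into the closed unit ball. -/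
theorem exists_isFixedPt_of_norm_le_one {f : E → E} (hf : Continuous f) (hb : ∀ x, ‖f x‖ ≤ 1) :
    ∃ x, Function.IsFixedPt f x := by
  obtain ⟨x, hx, hmin⟩ := (isCompact_closedBall (0 : E) 1).exists_isMinOn ⟨0, by simp⟩
    (f := fun x => ‖f x - x‖) (by fun_prop)
  refine ⟨x, ?_⟩
  by_contra hne
  have hpos : 0 < ‖f x - x‖ := norm_pos_iff.2 (sub_ne_zero.2 hne)
  set ε := ‖f x - x‖ / 3
  have hε : 0 < ε := by positivity
  obtain ⟨p, hp, hpf, -⟩ := hf.exists_contDiff_approx 1 (continuous_const (y := ε)) fun _ => hε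
  have hpn : ∀ y, ‖p y‖ < 1 + ε := fun y => by
    have h1 := hpf y
    rw [dist_eq_norm] at h1
    have h2 := norm_add_le (f y) (p y - f y)
    rw [add_sub_cancel] at h2
    linarith [hb y]
  obtain ⟨y, hy, hfix⟩ := exists_isFixedPt_of_contDiff (p := fun y => (1 + ε)⁻¹ • p y)
    (hp.const_smul _) fun y _ => by
      rw [norm_smul, Real.norm_of_nonneg (by positivity), inv_mul_lt_iff₀ (by positivity), mul_one]
      exact hpn y
  have hfix : (1 + ε)⁻¹ • p y = y := hfix
  have hpy : p y = (1 + ε) • y := by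
    rw [← hfix, smul_smul, mul_inv_cancel₀ (by positivity), one_smul, hfix]
  have h1 : ‖f x - x‖ ≤ ‖f y - y‖ := hmin hy
  have h2 : ‖f y - y‖ ≤ ‖p y - f y‖ + ‖ε • y‖ := by
    have : f y - y = -(p y - f y) + ε • y := by rw [hpy, add_smul, one_smul]; abel
    rw [this]
    exact (norm_add_le _ _).trans (by rw [norm_neg])
  have h3 : ‖ε • y‖ ≤ ε := by
    rw [norm_smul, Real.norm_of_nonneg hε.le]
    exact mul_le_of_le_one_right hε.le (by simpa using hy)
  have h4 := hpf y
  rw [dist_eq_norm] at h4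
  have : ‖f x - x‖ = 3 * ε := by simp only [ε]; ring
  linarith

end Brouwer

section Schauder

open Metric

variable {V : Type*} [NormedAddCommGroup V] [NormedSpace ℝ V]

/-- A continuous map of Euclidean space into the standard simplex that is the identity there. -/
lemma exists_retraction_stdSimplex (ι : Type*) [Fintype ι] [Nonempty ι] :
    ∃ h : EuclideanSpace ℝ ι → ι → ℝ, Continuous h ∧ (∀ x, h x ∈ stdSimplex ℝ ι) ∧
      ∀ x, x.ofLp ∈ stdSimplex ℝ ι → h x = x.ofLp := by
  let S : EuclideanSpace ℝ ι → ℝ := fun x => ∑ j, max (x j) 0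
  have hS : Continuous S := by fun_prop
  have hmax : ∀ x, 0 < max (S x) 1 := fun x => lt_max_of_lt_right one_pos
  refine ⟨fun x i => (max (x i) 0 + max (1 - S x) 0 / Fintype.card ι) / max (S x) 1, ?_, ?_, ?_⟩
  · refine continuous_pi fun i => Continuous.div ?_ ?_ fun x => (hmax x).ne' <;> fun_prop
  · refine fun x => ⟨fun i => by have := hmax x; positivity, ?_⟩
    rw [← Finset.sum_div, Finset.sum_add_distrib, Finset.sum_const, Finset.card_univ, nsmul_eq_mul,
      mul_div_cancel₀ _ (by simp), div_eq_one_iff_eq (hmax x).ne']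
    change S x + _ = _
    rcases le_total (S x) 1 with h | h
    · rw [max_eq_left (sub_nonneg.2 h), max_eq_right h]; ring
    · rw [max_eq_right (sub_nonpos.2 h), max_eq_left h, add_zero]
  · rintro x ⟨hx0, hx1⟩
    have hSx : S x = 1 := by
      rw [← hx1]
      exact Finset.sum_congr rfl fun j _ => max_eq_left (hx0 j)
    ext i
    simp [hSx, hx0 i]

/-- Approximate form of Schauder's theorem. -/
lemma exists_norm_sub_le_of_isCompact_convex {C : Set V} (hC : IsCompact C) (hconv : Convex ℝ C)
    (hne : C.Nonempty) {T : V → V} (hT : ContinuousOn T C) (hmaps : MapsTo T C C)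
    {ε : ℝ} (hε : 0 < ε) : ∃ x ∈ C, ‖T x - x‖ ≤ ε := by
  obtain ⟨t, htC, htfin, hcover⟩ := hC.finite_cover_balls hε
  have htne : t.Nonempty := by
    obtain ⟨x, hx⟩ := hne
    obtain ⟨y, hy, -⟩ := mem_iUnion₂.1 (hcover hx)
    exact ⟨y, hy⟩
  have : Fintype t := htfin.fintype
  have : Nonempty t := htne.to_subtype
  obtain ⟨h, hcont, hmem, hid⟩ := exists_retraction_stdSimplex t
  let σ : EuclideanSpace ℝ t → V := fun x => ∑ i, h x i • (i : V)
  have hσ : Continuous σ := by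
    refine continuous_finsetSum _ fun i _ => Continuous.smul ?_ continuous_const
    exact (continuous_apply i).comp hcont
  have hσC : ∀ x, σ x ∈ C := fun x =>
    hconv.sum_mem (fun i _ => (hmem x).1 i) (hmem x).2 fun i _ => htC i.2
  let φ : t → V → ℝ := fun i y => max (ε - ‖y - i‖) 0
  have hφ0 : ∀ i y, 0 ≤ φ i y := fun i y => le_max_right _ _
  have hΦ : ∀ y ∈ C, 0 < ∑ i, φ i y := by
    intro y hy
    obtain ⟨z, hz, hyz⟩ := mem_iUnion₂.1 (hcover hy)
    refine Finset.sum_pos' (fun i _ => hφ0 i y) ⟨⟨z, hz⟩, Finset.mem_univ _, ?_⟩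
    rw [mem_ball, dist_eq_norm] at hyz
    exact lt_max_of_lt_left (sub_pos.2 hyz)
  have hTσ : Continuous fun x => T (σ x) := hT.comp_continuous hσ hσC
  let G : EuclideanSpace ℝ t → EuclideanSpace ℝ t := fun x =>
    WithLp.toLp 2 fun i => φ i (T (σ x)) / ∑ j, φ j (T (σ x))
  have hGs : ∀ x, (G x).ofLp ∈ stdSimplex ℝ t := by
    intro x
    have hpos := hΦ _ (hmaps (hσC x))
    refine ⟨fun i => div_nonneg (hφ0 _ _) hpos.le, ?_⟩
    change ∑ i, φ i (T (σ x)) / _ = 1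
    rw [← Finset.sum_div, div_self hpos.ne']
  have hφc : ∀ i, Continuous fun x => φ i (T (σ x)) := fun i =>
    (continuous_const.sub (hTσ.sub continuous_const).norm).max continuous_const
  have hGc : Continuous G := by
    refine (PiLp.continuous_toLp 2 _).comp (continuous_pi fun i => ?_)
    exact (hφc i).div (continuous_finsetSum _ fun j _ => hφc j)
      fun x => (hΦ _ (hmaps (hσC x))).ne'
  have hGb : ∀ x, ‖G x‖ ≤ 1 := by
    intro x
    obtain ⟨h0, h1⟩ := hGs x
    rw [EuclideanSpace.norm_eq, Real.sqrt_le_iff, one_pow, ← h1]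
    refine ⟨Finset.sum_nonneg fun i _ => h0 i, ?_⟩
    refine Finset.sum_le_sum fun i _ => ?_
    have : (G x) i ≤ 1 := h1 ▸ Finset.single_le_sum (fun j _ => h0 j) (Finset.mem_univ i)
    rw [Real.norm_eq_abs, sq_abs]
    have h0i : 0 ≤ (G x) i := h0 i
    nlinarith
  obtain ⟨x, hx⟩ := exists_isFixedPt_of_norm_le_one hGc hGb
  have hx : G x = x := hx
  have hxs : x.ofLp ∈ stdSimplex ℝ t := hx ▸ hGs x
  have hhx := hid x hxs
  refine ⟨σ x, hσC x, ?_⟩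
  have hsub : T (σ x) - σ x = ∑ i, x i • (T (σ x) - (i : V)) := by
    simp only [smul_sub, Finset.sum_sub_distrib]
    rw [← Finset.sum_smul, hxs.2, one_smul]
    congr 1
    simp only [σ, hhx]
  rw [hsub]
  calc ‖∑ i, x i • (T (σ x) - (i : V))‖ ≤ ∑ i, x i * ε := by
        refine norm_sum_le_of_le _ fun i _ => ?_
        rw [norm_smul, Real.norm_of_nonneg (hxs.1 i)]
        rcases le_or_gt ‖T (σ x) - i‖ ε with hle | hgt
        · exact mul_le_mul_of_nonneg_left hle (hxs.1 i)
        · have : x i = 0 := by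
            conv_lhs => rw [← hx]
            have : φ i (T (σ x)) = 0 := max_eq_right (sub_nonpos.2 hgt.le)
            simp [G, this]
          simp [this]
    _ = ε := by rw [← Finset.sum_mul, hxs.2, one_mul]

/-- **Schauder's fixed point theorem** on a compact convex set. -/
theorem exists_isFixedPt_of_isCompact_convex {C : Set V} (hC : IsCompact C) (hconv : Convex ℝ C)
    (hne : C.Nonempty) {T : V → V} (hT : ContinuousOn T C) (hmaps : MapsTo T C C) :
    ∃ x ∈ C, Function.IsFixedPt T x := by
  obtain ⟨x, hx, hmin⟩ := hC.exists_isMinOn hne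
    (f := fun x => ‖T x - x‖) (hT.sub continuousOn_id).norm
  refine ⟨x, hx, ?_⟩
  by_contra hfix
  have hpos : 0 < ‖T x - x‖ := norm_pos_iff.2 (sub_ne_zero.2 hfix)
  obtain ⟨y, hy, hyle⟩ := exists_norm_sub_le_of_isCompact_convex hC hconv hne hT hmaps
    (half_pos hpos)
  have : ‖T x - x‖ ≤ ‖T y - y‖ := hmin hy
  linarith

end Schauder

/-! ### Tail integrals in the variable `y = 1 / t` -/

section TailIntegral

/-- The integral of `h` over `{s ≥ t₀ | 1 < y s}`, i.e. over `(1 / y, ∞)` when `0 < y ≤ 1 / t₀`. -/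
def tailIntegral (t₀ : ℝ) (h : ℝ → ℝ) (y : ℝ) : ℝ :=
  ∫ s in Ici t₀, {s | 1 < y * s}.indicator h s

variable {t₀ : ℝ} {h K : ℝ → ℝ}

lemma measurableSet_one_lt_mul (y : ℝ) : MeasurableSet {s : ℝ | 1 < y * s} :=
  measurableSet_lt measurable_const (measurable_const_mul y)

lemma tailIntegral_zero : tailIntegral t₀ h 0 = 0 := by
  simp [tailIntegral]

lemma tailIntegral_inv (ht₀ : 0 < t₀) {t : ℝ} (ht : t₀ ≤ t) :
    tailIntegral t₀ h t⁻¹ = ∫ s in Ioi t, h s := by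
  have htp := ht₀.trans_le ht
  have : Ici t₀ ∩ {s : ℝ | 1 < t⁻¹ * s} = Ioi t := by
    ext s
    simp only [mem_inter_iff, mem_Ici, mem_ofPred_eq, mem_Ioi, lt_inv_mul_iff₀ htp, mul_one]
    exact ⟨fun hs => hs.2, fun hs => ⟨(ht.trans_lt hs).le, hs⟩⟩
  rw [tailIntegral, setIntegral_indicator (measurableSet_one_lt_mul _), this]

lemma continuous_tailIntegral (hh : IntegrableOn h (Ici t₀)) :
    Continuous (tailIntegral t₀ h) := by
  rw [continuous_iff_continuousAt]
  intro y
  refine continuousAt_of_dominated (bound := fun s => ‖h s‖)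
    (.of_forall fun z => (hh.indicator (measurableSet_one_lt_mul z)).aestronglyMeasurable)
    (.of_forall fun z => .of_forall fun s => norm_indicator_le_norm_self _ _) hh.norm ?_
  have hnull : ∀ᵐ s ∂(volume : Measure ℝ), s ≠ y⁻¹ := by
    simp [ae_iff]
  filter_upwards [ae_restrict_of_ae hnull] with s hs
  have hys : y * s ≠ 1 := fun hy => hs (eq_inv_of_mul_eq_one_right hy)
  have hc : ContinuousAt (fun z : ℝ => z * s) y := by fun_prop
  rcases hys.lt_or_gt with hlt | hgt
  · refine (continuousAt_const (y := (0 : ℝ))).congr ?_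
    filter_upwards [hc.eventually_lt continuousAt_const hlt] with z hz
    exact (indicator_of_notMem (by simpa using hz.le) _).symm
  · refine (continuousAt_const (y := h s)).congr ?_
    filter_upwards [continuousAt_const.eventually_lt hc hgt] with z hz
    exact (indicator_of_mem (by simpa using hz) _).symm

lemma abs_tailIntegral_sub_le (ht₀ : 0 < t₀) (hh : IntegrableOn h (Ici t₀))
    (hK : IntegrableOn K (Ici t₀)) (hle : ∀ s ∈ Ici t₀, |h s| ≤ K s) (y y' : ℝ) :
    |tailIntegral t₀ h y - tailIntegral t₀ h y'| ≤
      |tailIntegral t₀ K y - tailIntegral t₀ K y'| := by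
  wlog hyy : y ≤ y' generalizing y y'
  · rw [abs_sub_comm, abs_sub_comm (tailIntegral t₀ K y)]
    exact this y' y (le_of_not_ge hyy)
  have hi : ∀ {f : ℝ → ℝ}, IntegrableOn f (Ici t₀) → ∀ z, Integrable
      ({s | 1 < z * s}.indicator f) (volume.restrict (Ici t₀)) := fun hf z =>
    hf.indicator (measurableSet_one_lt_mul z)
  rw [abs_sub_comm, abs_sub_comm (tailIntegral t₀ K y)]
  simp only [tailIntegral]
  rw [← integral_sub (hi hh y') (hi hh y), ← integral_sub (hi hK y') (hi hK y)]
  refine le_trans ?_ (le_abs_self _)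
  rw [← Real.norm_eq_abs]
  refine norm_integral_le_of_norm_le ((hi hK y').sub (hi hK y)) ?_
  filter_upwards [ae_restrict_mem measurableSet_Ici] with s hs
  have hsp : 0 ≤ s := ht₀.le.trans hs
  have hle' := hle s hs
  have hmono : 1 < y * s → 1 < y' * s := fun h1 => h1.trans_le (mul_le_mul_of_nonneg_right hyy hsp)
  by_cases h1 : 1 < y * s
  · simp [indicator, h1, hmono h1]
  · by_cases h2 : 1 < y' * s
    · simpa [indicator, h1, h2] using hle'
    · simp [indicator, h1, h2]

lemma abs_tailIntegral_sub_le_integral {h' : ℝ → ℝ} (hh : IntegrableOn h (Ici t₀))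
    (hh' : IntegrableOn h' (Ici t₀)) (y : ℝ) :
    |tailIntegral t₀ h y - tailIntegral t₀ h' y| ≤ ∫ s in Ici t₀, |h s - h' s| := by
  simp only [tailIntegral]
  rw [← integral_sub (hh.indicator (measurableSet_one_lt_mul y))
    (hh'.indicator (measurableSet_one_lt_mul y)), ← Real.norm_eq_abs]
  refine norm_integral_le_of_norm_le (hh.sub hh').norm (.of_forall fun s => ?_)
  by_cases h1 : 1 < y * s <;> simp [indicator, h1]

end TailIntegral

/-! ### The space of candidate solutions -/

section Candidates

/-- The point `1 / t` of the unit interval, for `t ≥ 1`. -/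
def invPoint (t : ℝ) : unitInterval := projIcc 0 1 zero_le_one (max 1 t)⁻¹

lemma continuous_invPoint : Continuous invPoint := by
  refine continuous_projIcc.comp (Continuous.inv₀ (by fun_prop) fun t => ?_)
  have : (1 : ℝ) ≤ max 1 t := le_max_left _ _
  positivity

lemma coe_invPoint {t : ℝ} (ht : 1 ≤ t) : (invPoint t : ℝ) = t⁻¹ := by
  rw [invPoint, coe_projIcc, max_eq_right ht, min_eq_right (inv_le_one_of_one_le₀ ht),
    max_eq_right (by positivity)]

/-- The family of functions of `t` encoded by a vector-valued function of `1 / t`. -/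
def familyOf (r : ℕ) (w : BoundedContinuousFunction unitInterval (Fin (r + 1) → ℝ)) (i : ℕ)
    (t : ℝ) : ℝ :=
  w (invPoint t) (Fin.ofNat (r + 1) (i - 1))

variable {r : ℕ}

lemma continuous_familyOf (i : ℕ) :
    Continuous fun p : BoundedContinuousFunction unitInterval (Fin (r + 1) → ℝ) × ℝ =>
      familyOf r p.1 i p.2 := by
  have h : Continuous fun p : BoundedContinuousFunction unitInterval (Fin (r + 1) → ℝ) × ℝ =>
      p.1 (invPoint p.2) :=
    continuous_eval.comp (continuous_fst.prodMk (continuous_invPoint.comp continuous_snd))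
  exact (continuous_apply _).comp h

lemma continuousOn_RHO_familyOf {t₀ : ℝ} {k : ℕ} {a : ℕ → ℝ}
    {P : ℝ → (Fin (k + r + 1) → ℝ) → ℝ}
    (hP : ContinuousOn (fun p : ℝ × (Fin (k + r + 1) → ℝ) => P p.1 p.2) (Ici t₀ ×ˢ univ)) :
    ContinuousOn (fun p : BoundedContinuousFunction unitInterval (Fin (r + 1) → ℝ) × ℝ =>
      RHO t₀ k r a P (familyOf r p.1) p.2) (univ ×ˢ Ici t₀) := by
  have hx : Continuous fun p : BoundedContinuousFunction unitInterval (Fin (r + 1) → ℝ) × ℝ =>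
      xzHO r (familyOf r p.1) p.2 :=
    continuous_finsetSum _ fun q _ => Continuous.mul (by fun_prop) (continuous_familyOf q)
  have hS : ∀ d, Continuous fun p : BoundedContinuousFunction unitInterval (Fin (r + 1) → ℝ) × ℝ =>
      SdHO r (familyOf r p.1) d p.2 := fun d =>
    continuous_finsetSum _ fun q _ => Continuous.mul (by fun_prop) (continuous_familyOf q)
  have hQ : ∀ d, Continuous fun p : BoundedContinuousFunction unitInterval (Fin (r + 1) → ℝ) × ℝ =>
      QpHO t₀ k a d (xzHO r (familyOf r p.1)) p.2 := by
    intro d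
    refine Continuous.add (by fun_prop) ?_
    refine intervalIntegral.continuous_parametric_intervalIntegral_of_continuous
      (f := fun (p : BoundedContinuousFunction unitInterval (Fin (r + 1) → ℝ) × ℝ) s =>
        (p.2 - s) ^ (k - d - 1) / (Nat.factorial (k - d - 1)) * xzHO r (familyOf r p.1) s)
      ?_ continuous_snd
    refine Continuous.mul (by fun_prop) ?_
    exact hx.comp ((continuous_fst.comp continuous_fst).prodMk continuous_snd)
  have hV : Continuous fun p : BoundedContinuousFunction unitInterval (Fin (r + 1) → ℝ) × ℝ =>
      (p.2, fun i : Fin (k + r + 1) => if i.1 < k then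
        QpHO t₀ k a i.1 (xzHO r (familyOf r p.1)) p.2
        else SdHO r (familyOf r p.1) (i.1 - k + 1) p.2) := by
    refine continuous_snd.prodMk (continuous_pi fun i => ?_)
    split_ifs
    · exact hQ _
    · exact hS _
  exact hP.comp hV.continuousOn fun p hp => ⟨hp.2, mem_univ _⟩

/-- The candidates: members of `Z_M`, in the variable `1 / t`, with limit `(c, 0, …, 0)` at infinity
and with the modulus of continuity given by the tails of `K`. -/
def candidates (t₀ c : ℝ) (r : ℕ) (s : ℕ → ℝ) (K : ℝ → ℝ) :
    Set (BoundedContinuousFunction unitInterval (Fin (r + 1) → ℝ)) :=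
  {w | (∀ j, w 0 j = if j = 0 then c else 0) ∧ ZM t₀ c r s K (familyOf r w) ∧
    ∀ (y y' : unitInterval) j, |w y j - w y' j| ≤ |tailIntegral t₀ K y - tailIntegral t₀ K y'|}

variable {t₀ c : ℝ} {s : ℕ → ℝ} {K : ℝ → ℝ}

lemma convex_candidates : Convex ℝ (candidates t₀ c r s K) := by
  rintro w ⟨hw0, ⟨-, hw1, hwi⟩, hwm⟩ v ⟨hv0, ⟨-, hv1, hvi⟩, hvm⟩ α β hα hβ hαβ
  have key : ∀ {x y d B : ℝ}, |x - d| ≤ B → |y - d| ≤ B → |α * x + β * y - d| ≤ B := by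
    intro x y d B hx hy
    have : α * x + β * y - d = α * (x - d) + β * (y - d) := by linear_combination d * hαβ
    rw [this]
    calc |α * (x - d) + β * (y - d)| ≤ α * |x - d| + β * |y - d| := by
          refine (abs_add_le _ _).trans ?_
          rw [abs_mul, abs_mul, abs_of_nonneg hα, abs_of_nonneg hβ]
      _ ≤ α * B + β * B := by gcongr
      _ = B := by rw [← add_mul, hαβ, one_mul]
  refine ⟨fun j => ?_, ⟨fun i _ => ?_, fun t ht => key (hw1 t ht) (hv1 t ht), fun i hi t ht => ?_⟩,
    fun y y' j => ?_⟩
  · change α * w 0 j + β * v 0 j = _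
    rw [hw0, hv0, ← add_mul, hαβ, one_mul]
  · exact ((continuous_familyOf i).comp (Continuous.prodMk_right _)).continuousOn
  · have h1 := hwi i hi t ht
    have h2 := hvi i hi t ht
    rw [← sub_zero (familyOf r _ i t)] at h1 h2 ⊢
    exact key h1 h2
  · have h1 := hwm y y' j
    have h2 := hvm y y' j
    rw [← sub_zero (w y j - w y' j)] at h1
    rw [← sub_zero (v y j - v y' j)] at h2
    have h3 := key h1 h2
    rw [sub_zero] at h3
    change |(α * w y j + β * v y j) - (α * w y' j + β * v y' j)| ≤ _
    convert h3 using 2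
    ring

lemma isClosed_candidates : IsClosed (candidates t₀ c r s K) := by
  have hev : ∀ (y : unitInterval) (j : Fin (r + 1)), Continuous
      fun w : BoundedContinuousFunction unitInterval (Fin (r + 1) → ℝ) => w y j := fun y j =>
    (continuous_apply j).comp (continuous_eval_const y)
  have hfam : ∀ i t, Continuous
      fun w : BoundedContinuousFunction unitInterval (Fin (r + 1) → ℝ) => familyOf r w i t :=
    fun i t => hev _ _
  have hcont : ∀ w : BoundedContinuousFunction unitInterval (Fin (r + 1) → ℝ),
      ∀ i ∈ Finset.Icc 1 (r + 1), ContinuousOn (familyOf r w i) (Ici t₀) := fun w i _ =>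
    ((continuous_familyOf i).comp (Continuous.prodMk_right w)).continuousOn
  have hset : candidates t₀ c r s K = {w | (∀ j, w 0 j = if j = 0 then c else 0) ∧
      ((∀ t ∈ Ici t₀, |familyOf r w 1 t - c| ≤ s 1 / s 0 * ∫ τ in Ioi t, K τ) ∧
        ∀ i ∈ Finset.Icc 2 (r + 1), ∀ t ∈ Ici t₀,
          |familyOf r w i t| ≤ s i / s 0 * ∫ τ in Ioi t, K τ / τ ^ (i - 1)) ∧
      ∀ (y y' : unitInterval) j,
        |w y j - w y' j| ≤ |tailIntegral t₀ K y - tailIntegral t₀ K y'|} := by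
    ext w
    exact ⟨fun ⟨h1, ⟨_, h2⟩, h3⟩ => ⟨h1, h2, h3⟩, fun ⟨h1, h2, h3⟩ => ⟨h1, ⟨hcont w, h2⟩, h3⟩⟩
  rw [hset]
  simp only [ofPred_and, ofPred_forall]
  refine IsClosed.inter ?_ (IsClosed.inter (IsClosed.inter ?_ ?_) ?_)
  · exact isClosed_iInter fun j => isClosed_eq (hev 0 j) continuous_const
  · exact isClosed_biInter fun t _ => isClosed_le ((hfam 1 t).sub continuous_const).abs
      continuous_const
  · exact isClosed_biInter fun i _ => isClosed_biInter fun t _ =>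
      isClosed_le (hfam i t).abs continuous_const
  · exact isClosed_iInter fun y => isClosed_iInter fun y' => isClosed_iInter fun j =>
      isClosed_le ((hev y j).sub (hev y' j)).abs continuous_const

lemma isCompact_candidates (hK : IntegrableOn K (Ici t₀)) :
    IsCompact (candidates t₀ c r s K) := by
  have hκ : Continuous fun y : unitInterval => tailIntegral t₀ K y :=
    (continuous_tailIntegral hK).comp continuous_subtype_val
  obtain ⟨B, hB⟩ := isCompact_univ.exists_bound_of_continuousOn hκ.continuousOn
  refine BoundedContinuousFunction.arzela_ascoli₂ (Metric.closedBall 0 (|c| + B))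
    (isCompact_closedBall _ _) _ isClosed_candidates ?_ ?_
  · rintro w y ⟨hw0, -, hwm⟩
    have hB0 : 0 ≤ B := (norm_nonneg _).trans (hB 0 (mem_univ _))
    rw [mem_closedBall_zero_iff, pi_norm_le_iff_of_nonneg (by positivity)]
    intro j
    have h1 := hwm y 0 j
    have h2 := hB y (mem_univ _)
    rw [Real.norm_eq_abs] at h2 ⊢
    rw [Set.Icc.coe_zero, tailIntegral_zero, sub_zero] at h1
    have h3 : |w 0 j| ≤ |c| := by
      rw [hw0]; split_ifs <;> simp
    have h4 := abs_add_le (w y j - w 0 j) (w 0 j)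
    rw [sub_add_cancel] at h4
    linarith
  · intro y
    refine Metric.equicontinuousAt_of_continuity_modulus
      (fun y' : unitInterval => |tailIntegral t₀ K y - tailIntegral t₀ K y'|) ?_ _ ?_
    · have : ContinuousAt (fun y' : unitInterval => |tailIntegral t₀ K y - tailIntegral t₀ K y'|) y :=
        (continuous_const.sub hκ).abs.continuousAt
      simpa [ContinuousAt] using this
    · refine .of_forall fun y' w => ?_
      rw [dist_pi_le_iff (abs_nonneg _)]
      exact fun j => w.2.2.2 y y' j

lemma candidates_nonempty (ht₀ : 1 ≤ t₀) (hs : ∀ i ∈ Finset.Icc 1 (r + 1), 0 ≤ s i / s 0)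
    (hK0 : ∀ t ∈ Ici t₀, 0 ≤ K t) : (candidates t₀ c r s K).Nonempty := by
  have hgint : ∀ (i : ℕ), ∀ t ∈ Ici t₀, 0 ≤ ∫ τ in Ioi t, K τ / τ ^ i := fun i t ht =>
    setIntegral_nonneg measurableSet_Ioi fun τ hτ => by
      have h1 : t₀ ≤ τ := le_trans ht (le_of_lt hτ)
      have h2 : 0 ≤ τ := by linarith
      exact div_nonneg (hK0 τ h1) (pow_nonneg h2 i)
  refine ⟨BoundedContinuousFunction.const _ fun j => if j = 0 then c else 0, fun j => rfl,
    ⟨fun i _ => ?_, fun t ht => ?_, fun i hi t ht => ?_⟩, fun y y' j => ?_⟩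
  · exact ((continuous_familyOf i).comp (Continuous.prodMk_right _)).continuousOn
  · have h1 := mul_nonneg (hs 1 (by simp)) (hgint 0 t ht)
    simpa [familyOf] using h1
  · rw [Finset.mem_Icc] at hi
    have h1 := mul_nonneg (hs i (by simp; omega)) (hgint (i - 1) t ht)
    have hne : Fin.ofNat (r + 1) (i - 1) ≠ 0 := by
      intro h0
      have := congrArg Fin.val h0
      rw [Fin.val_ofNat, Nat.mod_eq_of_lt (by omega)] at this
      simp at this
      omega
    change |if Fin.ofNat (r + 1) (i - 1) = 0 then c else 0| ≤ _
    rw [if_neg hne, abs_zero]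
    exact h1
  · simp

end Candidates

/-! ### The integral operator -/

section SolutionOperator

/-- The right-hand side `t^{r-j}/(r-j)! · R(t,z)` of the system up to sign, for the family `z`
encoded by `w`. -/
def weightedRHO (t₀ : ℝ) (k r : ℕ) (a : ℕ → ℝ) (P : ℝ → (Fin (k + r + 1) → ℝ) → ℝ)
    (w : BoundedContinuousFunction unitInterval (Fin (r + 1) → ℝ)) (j : ℕ) (t : ℝ) : ℝ :=
  t ^ (r - j) / (Nat.factorial (r - j)) * RHO t₀ k r a P (familyOf r w) t

open Classical in
/-- The integral operator whose fixed points are the solutions of the system with limit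
`(c, 0, …, 0)` at infinity. -/
def solutionOperator (t₀ c : ℝ) (k r : ℕ) (a : ℕ → ℝ) (P : ℝ → (Fin (k + r + 1) → ℝ) → ℝ)
    (w : BoundedContinuousFunction unitInterval (Fin (r + 1) → ℝ)) :
    BoundedContinuousFunction unitInterval (Fin (r + 1) → ℝ) :=
  if h : Continuous fun (y : unitInterval) (j : Fin (r + 1)) => (if j = 0 then c else 0) -
      (-1) ^ (r - j.1) * tailIntegral t₀ (weightedRHO t₀ k r a P w j) y
  then .mkOfCompact ⟨_, h⟩ else 0

variable {t₀ c : ℝ} {k r : ℕ} {a : ℕ → ℝ} {P : ℝ → (Fin (k + r + 1) → ℝ) → ℝ} {s : ℕ → ℝ}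
  {K : ℝ → ℝ} {w : BoundedContinuousFunction unitInterval (Fin (r + 1) → ℝ)}

lemma abs_weightedRHO_le (ht₀ : 1 ≤ t₀)
    (hR : ∀ z, ZM t₀ c r s K z → ∀ t ∈ Ici t₀, t ^ r * |RHO t₀ k r a P z t| ≤ K t)
    (hw : w ∈ candidates t₀ c r s K) {j : ℕ} (hj : j ≤ r) {t : ℝ} (ht : t ∈ Ici t₀) :
    |weightedRHO t₀ k r a P w j t| ≤ K t / t ^ j := by
  have htp : 0 < t := lt_of_lt_of_le (by linarith) ht
  have h1 := hR _ hw.2.1 t ht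
  rw [weightedRHO, abs_mul, abs_of_nonneg (by positivity), le_div_iff₀ (by positivity)]
  refine le_trans ?_ h1
  have h2 : t ^ (r - j) / (Nat.factorial (r - j)) ≤ t ^ (r - j) :=
    div_le_self (by positivity) (by exact_mod_cast Nat.factorial_pos _)
  calc t ^ (r - j) / (Nat.factorial (r - j)) * |RHO t₀ k r a P (familyOf r w) t| * t ^ j
      ≤ t ^ (r - j) * |RHO t₀ k r a P (familyOf r w) t| * t ^ j := by gcongr
    _ = t ^ r * |RHO t₀ k r a P (familyOf r w) t| := by
      rw [← pow_sub_mul_pow t hj]; ring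

lemma abs_weightedRHO_le_self (ht₀ : 1 ≤ t₀) (hK0 : ∀ t ∈ Ici t₀, 0 ≤ K t)
    (hR : ∀ z, ZM t₀ c r s K z → ∀ t ∈ Ici t₀, t ^ r * |RHO t₀ k r a P z t| ≤ K t)
    (hw : w ∈ candidates t₀ c r s K) {j : ℕ} (hj : j ≤ r) {t : ℝ} (ht : t ∈ Ici t₀) :
    |weightedRHO t₀ k r a P w j t| ≤ K t :=
  (abs_weightedRHO_le ht₀ hR hw hj ht).trans
    (div_le_self (hK0 t ht) (one_le_pow₀ (ht₀.trans ht)))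

lemma continuousOn_weightedRHO
    (hP : ContinuousOn (fun p : ℝ × (Fin (k + r + 1) → ℝ) => P p.1 p.2) (Ici t₀ ×ˢ univ)) (j : ℕ) :
    ContinuousOn (fun p : BoundedContinuousFunction unitInterval (Fin (r + 1) → ℝ) × ℝ =>
      weightedRHO t₀ k r a P p.1 j p.2) (univ ×ˢ Ici t₀) :=
  ContinuousOn.mul (by fun_prop) (continuousOn_RHO_familyOf hP)

lemma continuousOn_weightedRHO_right
    (hP : ContinuousOn (fun p : ℝ × (Fin (k + r + 1) → ℝ) => P p.1 p.2) (Ici t₀ ×ˢ univ)) (j : ℕ) :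
    ContinuousOn (weightedRHO t₀ k r a P w j) (Ici t₀) :=
  (continuousOn_weightedRHO hP j).comp (f := fun t => (w, t))
    (Continuous.prodMk_right w).continuousOn fun _ ht => ⟨mem_univ _, ht⟩

lemma integrableOn_weightedRHO (ht₀ : 1 ≤ t₀)
    (hP : ContinuousOn (fun p : ℝ × (Fin (k + r + 1) → ℝ) => P p.1 p.2) (Ici t₀ ×ˢ univ))
    (hK0 : ∀ t ∈ Ici t₀, 0 ≤ K t) (hKint : IntegrableOn K (Ici t₀))
    (hR : ∀ z, ZM t₀ c r s K z → ∀ t ∈ Ici t₀, t ^ r * |RHO t₀ k r a P z t| ≤ K t)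
    (hw : w ∈ candidates t₀ c r s K) {j : ℕ} (hj : j ≤ r) :
    IntegrableOn (weightedRHO t₀ k r a P w j) (Ici t₀) := by
  refine Integrable.mono' hKint
    ((continuousOn_weightedRHO_right hP j).aestronglyMeasurable measurableSet_Ici) ?_
  filter_upwards [ae_restrict_mem measurableSet_Ici] with t ht
  exact abs_weightedRHO_le_self ht₀ hK0 hR hw hj ht

lemma solutionOperator_apply
    (h : ∀ j ≤ r, IntegrableOn (weightedRHO t₀ k r a P w j) (Ici t₀))
    (y : unitInterval) (j : Fin (r + 1)) :
    solutionOperator t₀ c k r a P w y j = (if j = 0 then c else 0) -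
      (-1) ^ (r - j.1) * tailIntegral t₀ (weightedRHO t₀ k r a P w j) y := by
  have hc : Continuous fun (y : unitInterval) (j : Fin (r + 1)) => (if j = 0 then c else 0) -
      (-1) ^ (r - j.1) * tailIntegral t₀ (weightedRHO t₀ k r a P w j) y :=
    continuous_pi fun j => continuous_const.sub (continuous_const.mul
      ((continuous_tailIntegral (h j (Nat.le_of_lt_succ j.2))).comp continuous_subtype_val))
  rw [solutionOperator, dif_pos hc]
  rfl

lemma familyOf_solutionOperator (ht₀ : 1 ≤ t₀)
    (h : ∀ j ≤ r, IntegrableOn (weightedRHO t₀ k r a P w j) (Ici t₀))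
    {i : ℕ} (hi : i ∈ Finset.Icc 1 (r + 1)) {t : ℝ} (ht : t ∈ Ici t₀) :
    familyOf r (solutionOperator t₀ c k r a P w) i t = (if i = 1 then c else 0) -
      (-1) ^ (r + 1 - i) * ∫ τ in Ioi t, weightedRHO t₀ k r a P w (i - 1) τ := by
  rw [Finset.mem_Icc] at hi
  have hval : (Fin.ofNat (r + 1) (i - 1)).1 = i - 1 := by
    rw [Fin.val_ofNat, Nat.mod_eq_of_lt (by omega)]
  have hzero : Fin.ofNat (r + 1) (i - 1) = 0 ↔ i = 1 := by
    rw [Fin.ext_iff, hval, Fin.val_zero]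
    omega
  rw [familyOf, solutionOperator_apply h, coe_invPoint (ht₀.trans ht),
    tailIntegral_inv (by linarith) ht, hval, show r - (i - 1) = r + 1 - i by omega]
  simp only [hzero]

lemma mapsTo_solutionOperator (ht₀ : 1 ≤ t₀)
    (hP : ContinuousOn (fun p : ℝ × (Fin (k + r + 1) → ℝ) => P p.1 p.2) (Ici t₀ ×ˢ univ))
    (hs : ∀ i ∈ Finset.Icc 1 (r + 1), 1 ≤ s i / s 0)
    (hK0 : ∀ t ∈ Ici t₀, 0 ≤ K t) (hKint : IntegrableOn K (Ici t₀))
    (hR : ∀ z, ZM t₀ c r s K z → ∀ t ∈ Ici t₀, t ^ r * |RHO t₀ k r a P z t| ≤ K t) :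
    MapsTo (solutionOperator t₀ c k r a P) (candidates t₀ c r s K) (candidates t₀ c r s K) := by
  intro w hw
  have hgint : ∀ j ≤ r, IntegrableOn (weightedRHO t₀ k r a P w j) (Ici t₀) := fun j hj =>
    integrableOn_weightedRHO ht₀ hP hK0 hKint hR hw hj
  have hbound : ∀ i ∈ Finset.Icc 1 (r + 1), ∀ t ∈ Ici t₀,
      |familyOf r (solutionOperator t₀ c k r a P w) i t - if i = 1 then c else 0| ≤
        s i / s 0 * ∫ τ in Ioi t, K τ / τ ^ (i - 1) := by
    intro i hi t ht
    have hir : i - 1 ≤ r := by rw [Finset.mem_Icc] at hi; omega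
    have hsub : Ioi t ⊆ Ici t₀ := Ioi_subset_Ici ht
    have hKt : ∀ τ ∈ Ioi t, 0 ≤ K τ / τ ^ (i - 1) := fun τ hτ =>
      div_nonneg (hK0 τ (hsub hτ)) (pow_nonneg (le_trans (by linarith) (hsub hτ)) _)
    have hKi : IntegrableOn (fun τ => K τ / τ ^ (i - 1)) (Ioi t) := by
      refine Integrable.mono' (hKint.mono_set hsub) ?_ ?_
      · exact (hKint.mono_set hsub).aestronglyMeasurable.div₀ (by fun_prop)
      · filter_upwards [ae_restrict_mem measurableSet_Ioi] with τ hτ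
        rw [Real.norm_eq_abs, abs_of_nonneg (hKt τ hτ)]
        exact div_le_self (hK0 τ (hsub hτ)) (one_le_pow₀ (ht₀.trans (hsub hτ)))
    rw [familyOf_solutionOperator ht₀ hgint hi ht, sub_sub_cancel_left, abs_neg, abs_mul, abs_pow,
      abs_neg, abs_one, one_pow, one_mul, ← Real.norm_eq_abs]
    refine (norm_integral_le_of_norm_le hKi ?_).trans
      (le_mul_of_one_le_left (setIntegral_nonneg measurableSet_Ioi hKt) (hs i hi))
    filter_upwards [ae_restrict_mem measurableSet_Ioi] with τ hτ
    exact abs_weightedRHO_le ht₀ hR hw hir (hsub hτ)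
  refine ⟨fun j => ?_, ⟨fun i _ => ?_, fun t ht => ?_, fun i hi t ht => ?_⟩, fun y y' j => ?_⟩
  · rw [solutionOperator_apply hgint, Set.Icc.coe_zero, tailIntegral_zero, mul_zero, sub_zero]
  · exact ((continuous_familyOf i).comp (Continuous.prodMk_right _)).continuousOn
  · simpa using hbound 1 (by simp) t ht
  · rw [Finset.mem_Icc] at hi
    have h1 := hbound i (by simp; omega) t ht
    rwa [if_neg (by omega), sub_zero] at h1
  · have hj := Nat.le_of_lt_succ j.2
    rw [solutionOperator_apply hgint, solutionOperator_apply hgint, sub_sub_sub_cancel_left,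
      ← mul_sub, abs_mul, abs_pow, abs_neg, abs_one, one_pow, one_mul, abs_sub_comm]
    exact abs_tailIntegral_sub_le (by linarith) (hgint j hj) hKint
      (fun τ hτ => abs_weightedRHO_le_self ht₀ hK0 hR hw hj hτ) _ _

lemma continuousOn_solutionOperator (ht₀ : 1 ≤ t₀)
    (hP : ContinuousOn (fun p : ℝ × (Fin (k + r + 1) → ℝ) => P p.1 p.2) (Ici t₀ ×ˢ univ))
    (hK0 : ∀ t ∈ Ici t₀, 0 ≤ K t) (hKint : IntegrableOn K (Ici t₀))
    (hR : ∀ z, ZM t₀ c r s K z → ∀ t ∈ Ici t₀, t ^ r * |RHO t₀ k r a P z t| ≤ K t) :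
    ContinuousOn (solutionOperator t₀ c k r a P) (candidates t₀ c r s K) := by
  have hgint : ∀ w ∈ candidates t₀ c r s K, ∀ j ≤ r,
      IntegrableOn (weightedRHO t₀ k r a P w j) (Ici t₀) := fun w hw j hj =>
    integrableOn_weightedRHO ht₀ hP hK0 hKint hR hw hj
  intro w₀ hw₀
  have hlim : ∀ j : Fin (r + 1), Tendsto (fun w => ∫ t in Ici t₀,
      |weightedRHO t₀ k r a P w j t - weightedRHO t₀ k r a P w₀ j t|)
      (𝓝[candidates t₀ c r s K] w₀) (𝓝 0) := by
    intro j
    have hj := Nat.le_of_lt_succ j.2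
    rw [show (0 : ℝ) = ∫ t in Ici t₀, (0 : ℝ) by simp]
    refine tendsto_integral_filter_of_dominated_convergence (fun t => 2 * K t) ?_ ?_
      (hKint.const_mul 2) ?_
    · filter_upwards [self_mem_nhdsWithin] with w hw
      exact ((hgint w hw j hj).sub (hgint w₀ hw₀ j hj)).abs.aestronglyMeasurable
    · filter_upwards [self_mem_nhdsWithin] with w hw
      filter_upwards [ae_restrict_mem measurableSet_Ici] with t ht
      have h1 := abs_weightedRHO_le_self ht₀ hK0 hR hw hj ht
      have h2 := abs_weightedRHO_le_self ht₀ hK0 hR hw₀ hj ht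
      rw [Real.norm_eq_abs, abs_abs]
      linarith [abs_sub (weightedRHO t₀ k r a P w j t) (weightedRHO t₀ k r a P w₀ j t)]
    · filter_upwards [ae_restrict_mem measurableSet_Ici] with t ht
      have hcont : Continuous fun w => weightedRHO t₀ k r a P w j t :=
        (continuousOn_weightedRHO hP j).comp_continuous (f := fun w => (w, t))
          (Continuous.prodMk_left t) fun w => ⟨mem_univ _, ht⟩
      have h1 : Tendsto (fun w => |weightedRHO t₀ k r a P w j t - weightedRHO t₀ k r a P w₀ j t|)
          (𝓝 w₀) (𝓝 |weightedRHO t₀ k r a P w₀ j t - weightedRHO t₀ k r a P w₀ j t|) :=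
        (hcont.sub continuous_const).abs.tendsto w₀
      rw [sub_self, abs_zero] at h1
      exact h1.mono_left nhdsWithin_le_nhds
  rw [ContinuousWithinAt, tendsto_iff_dist_tendsto_zero]
  have hsum := tendsto_finsetSum Finset.univ fun j _ => hlim j
  rw [Finset.sum_const_zero] at hsum
  refine squeeze_zero' (.of_forall fun w => dist_nonneg) ?_ hsum
  filter_upwards [self_mem_nhdsWithin] with w hw
  have hnn : ∀ j ∈ Finset.univ, 0 ≤ ∫ t in Ici t₀,
      |weightedRHO t₀ k r a P w (j : Fin (r + 1)) t - weightedRHO t₀ k r a P w₀ j t| := fun j _ =>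
    integral_nonneg fun t => abs_nonneg _
  rw [BoundedContinuousFunction.dist_le (Finset.sum_nonneg hnn)]
  intro y
  rw [dist_pi_le_iff (Finset.sum_nonneg hnn)]
  intro j
  have hj := Nat.le_of_lt_succ j.2
  refine le_trans ?_ (Finset.single_le_sum hnn (Finset.mem_univ j))
  rw [Real.dist_eq, solutionOperator_apply (hgint w hw), solutionOperator_apply (hgint w₀ hw₀),
    sub_sub_sub_cancel_left, ← mul_sub, abs_mul, abs_pow, abs_neg, abs_one, one_pow, one_mul,
    abs_sub_comm]
  exact abs_tailIntegral_sub_le_integral (hgint w hw j hj) (hgint w₀ hw₀ j hj) _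

end SolutionOperator

/-! ### Dependence on the values on `[t₀, ∞)` -/

section Congruence

variable {t₀ c : ℝ} {k r : ℕ} {a : ℕ → ℝ} {P : ℝ → (Fin (k + r + 1) → ℝ) → ℝ} {s : ℕ → ℝ}
  {K : ℝ → ℝ} {z z' : ℕ → ℝ → ℝ}

lemma RHO_congr (h : ∀ i ∈ Finset.Icc 1 (r + 1), EqOn (z i) (z' i) (Ici t₀)) {t : ℝ}
    (ht : t ∈ Ici t₀) : RHO t₀ k r a P z t = RHO t₀ k r a P z' t := by
  have hx : EqOn (xzHO r z) (xzHO r z') (Ici t₀) := fun τ hτ =>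
    Finset.sum_congr rfl fun q hq => by rw [h q hq hτ]
  have hQ : ∀ p, QpHO t₀ k a p (xzHO r z) t = QpHO t₀ k a p (xzHO r z') t := by
    intro p
    rw [QpHO, QpHO]
    congr 1
    refine intervalIntegral.integral_congr fun τ hτ => ?_
    rw [uIcc_of_le ht] at hτ
    simp only [hx hτ.1]
  have hS : ∀ d, SdHO r z (d + 1) t = SdHO r z' (d + 1) t := fun d =>
    Finset.sum_congr rfl fun l hl => by
      rw [Finset.mem_Icc] at hl
      rw [h l (by simp; omega) ht]
  simp only [RHO, hQ, hS]

lemma ZM.congr (hz : ZM t₀ c r s K z)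
    (h : ∀ i ∈ Finset.Icc 1 (r + 1), EqOn (z i) (z' i) (Ici t₀)) : ZM t₀ c r s K z' := by
  refine ⟨fun i hi => (hz.1 i hi).congr fun t ht => (h i hi ht).symm, fun t ht => ?_,
    fun i hi t ht => ?_⟩
  · rw [← h 1 (by simp) ht]
    exact hz.2.1 t ht
  · rw [← h i (by simp at hi ⊢; omega) ht]
    exact hz.2.2 i hi t ht

end Congruence

/-- A function which on `[t₀, ∞)` is a tail integral extends to the line as an antiderivative. -/
lemma exists_hasDerivAt_of_eqOn_integral_Ioi {t₀ b : ℝ} {f g : ℝ → ℝ}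
    (hg : ContinuousOn g (Ici t₀)) (hgi : IntegrableOn g (Ici t₀))
    (hf : ∀ t ∈ Ici t₀, f t = b - ∫ τ in Ioi t, g τ) :
    ∃ F : ℝ → ℝ, EqOn f F (Ici t₀) ∧ ∀ t ∈ Ici t₀, HasDerivAt F (g t) t := by
  have hG : Continuous fun τ => g (max t₀ τ) :=
    hg.comp_continuous (by fun_prop) fun τ => mem_Ici.2 (le_max_left _ _)
  refine ⟨fun t => f t₀ + ∫ τ in t₀..t, g (max t₀ τ), fun t ht => ?_, fun t ht => ?_⟩
  · have hsub := intervalIntegral.integral_Ioi_sub_Ioi (hgi.mono_set Ioi_subset_Ici_self) ht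
    have hcongr : ∫ τ in t₀..t, g (max t₀ τ) = ∫ τ in t₀..t, g τ := by
      refine intervalIntegral.integral_congr fun τ hτ => ?_
      rw [uIcc_of_le ht] at hτ
      simp only [max_eq_right hτ.1]
    simp only [hcongr, ← hsub]
    rw [hf t ht, hf t₀ self_mem_Ici]
    ring
  · have h1 := (hG.integral_hasStrictDerivAt t₀ t).hasDerivAt.const_add (f t₀)
    rwa [max_eq_right ht] at h1

/-- **Hale–Onuchic, Theorem 1.** Under `∫_{t₀}^∞ K ≤ s₀·M` and `t^r·|R(t,z)| ≤ K(t)` for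
all `z ∈ Z_M`, the system `z_i' = (-1)^{r+1-i} t^{r+1-i}/(r+1-i)! · R(t,z)` has a
continuously differentiable solution in `Z_M`. -/
theorem stmt_2 (k r : ℕ) (hkr : 1 ≤ k + r) (t₀ : ℝ) (ht₀ : 1 ≤ t₀)
    (a : ℕ → ℝ) (c : ℝ) (P : ℝ → (Fin (k + r + 1) → ℝ) → ℝ)
    (hP : ContinuousOn (fun p : ℝ × (Fin (k + r + 1) → ℝ) => P p.1 p.2)
      (Set.Ici t₀ ×ˢ Set.univ))
    (M : ℝ) (hM : 0 < M) (s : ℕ → ℝ) (hs0 : s 0 ∈ Set.Ioo (0 : ℝ) 1)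
    (hsd : ∀ d ∈ Finset.Icc 1 (r + 1), s d ∈ Set.Ico (s 0) 1)
    (hsum : ∑ d ∈ Finset.Icc 1 (r + 1), s d = 1)
    (K : ℝ → ℝ) (hK : ContinuousOn K (Set.Ici t₀)) (hK0 : ∀ t ∈ Set.Ici t₀, 0 ≤ K t)
    (hKint : IntegrableOn K (Set.Ici t₀))
    (hKM : (∫ τ in Set.Ici t₀, K τ) ≤ s 0 * M)
    (hR : ∀ z, ZM t₀ c r s K z →
      ∀ t ∈ Set.Ici t₀, t ^ r * |RHO t₀ k r a P z t| ≤ K t) :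
    ∃ z : ℕ → ℝ → ℝ, ZM t₀ c r s K z ∧
      ContinuousOn (fun t => RHO t₀ k r a P z t) (Set.Ici t₀) ∧
      ∀ i ∈ Finset.Icc 1 (r + 1), ∀ t ∈ Set.Ici t₀,
        HasDerivAt (z i)
          ((-1 : ℝ) ^ (r + 1 - i) * t ^ (r + 1 - i) / (Nat.factorial (r + 1 - i)) *
            RHO t₀ k r a P z t) t := by
  have hs : ∀ i ∈ Finset.Icc 1 (r + 1), 1 ≤ s i / s 0 := fun i hi =>
    (one_le_div hs0.1).2 (hsd i hi).1
  obtain ⟨w, hw, hfix⟩ := exists_isFixedPt_of_isCompact_convex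
    (isCompact_candidates (c := c) (r := r) (s := s) hKint) convex_candidates
    (candidates_nonempty ht₀ (fun i hi => zero_le_one.trans (hs i hi)) hK0)
    (continuousOn_solutionOperator ht₀ hP hK0 hKint hR)
    (mapsTo_solutionOperator ht₀ hP hs hK0 hKint hR)
  have hgint : ∀ j ≤ r, IntegrableOn (weightedRHO t₀ k r a P w j) (Ici t₀) := fun j hj =>
    integrableOn_weightedRHO ht₀ hP hK0 hKint hR hw hj
  have hext : ∀ i, ∃ F : ℝ → ℝ, i ∈ Finset.Icc 1 (r + 1) →
      EqOn (familyOf r w i) F (Ici t₀) ∧ ∀ t ∈ Ici t₀,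
        HasDerivAt F ((-1) ^ (r + 1 - i) * weightedRHO t₀ k r a P w (i - 1) t) t := by
    intro i
    by_cases hi : i ∈ Finset.Icc 1 (r + 1)
    · have hir : i - 1 ≤ r := by rw [Finset.mem_Icc] at hi; omega
      obtain ⟨F, hF⟩ := exists_hasDerivAt_of_eqOn_integral_Ioi (b := if i = 1 then c else 0)
        (f := familyOf r w i)
        ((continuousOn_weightedRHO_right (w := w) (a := a) hP (i - 1)).const_mul
          ((-1) ^ (r + 1 - i)))
        ((hgint (i - 1) hir).const_mul ((-1) ^ (r + 1 - i))) fun t ht => by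
          rw [integral_const_mul, ← familyOf_solutionOperator ht₀ hgint hi ht, hfix]
      exact ⟨F, fun _ => hF⟩
    · exact ⟨0, fun h => absurd h hi⟩
  choose z hz using hext
  have heq : ∀ i ∈ Finset.Icc 1 (r + 1), EqOn (familyOf r w i) (z i) (Ici t₀) := fun i hi =>
    (hz i hi).1
  refine ⟨z, hw.2.1.congr heq, ?_, fun i hi t ht => ?_⟩
  · refine ContinuousOn.congr ((continuousOn_RHO_familyOf (a := a) hP).comp (f := fun t => (w, t))
      (Continuous.prodMk_right w).continuousOn fun _ ht => ⟨mem_univ _, ht⟩) fun t ht => ?_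
    exact (RHO_congr heq ht).symm
  · convert (hz i hi).2 t ht using 1
    rw [← RHO_congr heq ht, weightedRHO]
    rw [Finset.mem_Icc] at hi
    rw [show r - (i - 1) = r + 1 - i by omega]
    ring
end
end

section
/- Let z ∈ Z_M be a continuously differentiable solution of the system z_i'(t) = (−1)^{r+1−i}·t^{r+1−i}/(r+1−i)!·R(t,z), 1 ≤ i ≤ r+1, t ≥ t₀, where ∫_{t₀}^∞ K(s) ds ≤ s₀·M and t^r·|R(t,z)| ≤ K(t) for all z ∈ Z_M and t ≥ t₀. Define y_i(t) := Σ_{l=i}^{r+1} t^{l−i}/(l−i)! · z_l(t) for 1 ≤ i ≤ r+1 and ψ(t) := (1/s₀)·∫_t^∞ K(τ) dτ. Then |y₁(t) − c| ≤ ψ(t) and |y_{i+1}(t)| ≤ ψ(t)/t^i for 1 ≤ i ≤ r and all t ≥ t₀, and moreover y₁ is r times differentiable with y₁^{(j)} = y_{j+1} for 0 ≤ j ≤ r. -/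
open Real MeasureTheory Filter Topology Set Asymptotics

noncomputable section

theorem SdHO_eq_sum_range (r : ℕ) (z : ℕ → ℝ → ℝ) (d : ℕ) (t : ℝ) :
    SdHO r z d t =
      ∑ m ∈ Finset.range (r + 2 - d), t ^ m / (Nat.factorial m) * z (d + m) t := by
  have h : Finset.Icc d (r + 1) = Finset.Ico d (r + 2) := by
    ext x
    simp only [Finset.mem_Icc, Finset.mem_Ico]
    omega
  rw [SdHO, h, Finset.sum_Ico_eq_sum_range]
  simp

/-- The coefficients of `(1 - 1) ^ n / n!` sum to zero for `n ≥ 1`. -/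
theorem sum_neg_one_pow_div_factorial {n : ℕ} (hn : n ≠ 0) :
    ∑ m ∈ Finset.range (n + 1),
      (-1 : ℝ) ^ (n - m) / ((Nat.factorial m) * (Nat.factorial (n - m))) = 0 := by
  have h := add_pow (1 : ℝ) (-1) n
  rw [add_neg_cancel, zero_pow hn] at h
  have h2 : ∑ m ∈ Finset.range (n + 1),
      (-1 : ℝ) ^ (n - m) / ((Nat.factorial m) * (Nat.factorial (n - m))) =
      (∑ m ∈ Finset.range (n + 1), (1 : ℝ) ^ m * (-1) ^ (n - m) * (n.choose m)) /
        (Nat.factorial n) := by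
    rw [Finset.sum_div]
    refine Finset.sum_congr rfl fun m hm => ?_
    rw [Nat.cast_choose ℝ (Nat.lt_succ_iff.mp (Finset.mem_range.mp hm))]
    have := Nat.factorial_ne_zero n
    field_simp
    simp
  rw [h2, ← h, zero_div]

/-- If `z_l' = (-1)^{r+1-l} t^{r+1-l}/(r+1-l)! ρ` for all `l`, then `S_j' = S_{j+1}`. -/
theorem hasDerivAt_SdHO {r j : ℕ} (hj : j ≤ r) {z : ℕ → ℝ → ℝ} {t ρ : ℝ}
    (hz : ∀ i ∈ Finset.Icc j (r + 1), HasDerivAt (z i)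
      ((-1 : ℝ) ^ (r + 1 - i) * t ^ (r + 1 - i) / (Nat.factorial (r + 1 - i)) * ρ) t) :
    HasDerivAt (SdHO r z j) (SdHO r z (j + 1) t) t := by
  obtain ⟨n, rfl⟩ := Nat.exists_eq_add_of_le hj
  have e1 : j + n + 2 - j = n + 1 + 1 := by omega
  have e2 : j + n + 2 - (j + 1) = n + 1 := by omega
  have hS : SdHO (j + n) z j = fun t => ∑ m ∈ Finset.range (n + 1 + 1),
      t ^ m / (Nat.factorial m) * z (j + m) t := by
    funext t
    rw [SdHO_eq_sum_range, e1]
  rw [hS, SdHO_eq_sum_range, e2]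
  have hterm : ∀ m ∈ Finset.range (n + 1 + 1),
      HasDerivAt (fun t => t ^ m / (Nat.factorial m) * z (j + m) t)
        ((m : ℝ) * t ^ (m - 1) / (Nat.factorial m) * z (j + m) t +
          (-1 : ℝ) ^ (n + 1 - m) / ((Nat.factorial m) * (Nat.factorial (n + 1 - m))) *
            (t ^ (n + 1) * ρ)) t := by
    intro m hm
    have hm' : m ≤ n + 1 := Nat.lt_succ_iff.mp (Finset.mem_range.mp hm)
    have h := hz (j + m) (Finset.mem_Icc.mpr ⟨by omega, by omega⟩)
    have e : j + n + 1 - (j + m) = n + 1 - m := by omega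
    rw [e] at h
    refine (((hasDerivAt_pow m t).div_const _).mul h).congr_deriv ?_
    have ht : t ^ (n + 1) = t ^ m * t ^ (n + 1 - m) := by
      rw [← pow_add, Nat.add_sub_cancel' hm']
    rw [ht]
    field_simp
  refine (HasDerivAt.fun_sum hterm).congr_deriv ?_
  rw [Finset.sum_add_distrib, ← Finset.sum_mul, sum_neg_one_pow_div_factorial n.succ_ne_zero,
    zero_mul, add_zero, Finset.sum_range_succ']
  simp only [Nat.cast_zero, zero_mul, zero_div, add_zero]
  refine Finset.sum_congr rfl fun m _ => ?_
  rw [Nat.factorial_succ, Nat.add_sub_cancel, show j + (m + 1) = j + 1 + m by omega]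
  push_cast
  field_simp

theorem setIntegral_Ioi_div_pow_le {K : ℝ → ℝ} {t : ℝ} (ht : 0 < t)
    (hK0 : ∀ τ ∈ Set.Ioi t, 0 ≤ K τ) (hK : IntegrableOn K (Set.Ioi t)) (n : ℕ) :
    ∫ τ in Set.Ioi t, K τ / τ ^ n ≤ (∫ τ in Set.Ioi t, K τ) / t ^ n := by
  rw [← integral_div]
  refine integral_mono_of_nonneg ?_ (hK.div_const _) ?_
  · filter_upwards [ae_restrict_mem measurableSet_Ioi] with τ hτ
    exact div_nonneg (hK0 τ hτ) (pow_nonneg (ht.trans hτ).le n)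
  · filter_upwards [ae_restrict_mem measurableSet_Ioi] with τ hτ
    have h := hK0 τ hτ
    have : t ≤ τ := le_of_lt hτ
    gcongr

theorem sum_Icc_taylor_abs_le {N d : ℕ} (hd : 1 ≤ d) {s v : ℕ → ℝ} {σ t I : ℝ} (ht : 0 < t)
    (hσ : 0 < σ) (hI : 0 ≤ I) (hs : ∀ l ∈ Finset.Icc 1 N, 0 ≤ s l)
    (hsum : ∑ l ∈ Finset.Icc 1 N, s l = 1)
    (hv : ∀ l ∈ Finset.Icc d N, |v l| ≤ s l / σ * (I / t ^ (l - 1))) :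
    |∑ l ∈ Finset.Icc d N, t ^ (l - d) / (Nat.factorial (l - d)) * v l| ≤
      1 / σ * I / t ^ (d - 1) := by
  have hsub : Finset.Icc d N ⊆ Finset.Icc 1 N := Finset.Icc_subset_Icc_left hd
  calc |∑ l ∈ Finset.Icc d N, t ^ (l - d) / (Nat.factorial (l - d)) * v l|
      ≤ ∑ l ∈ Finset.Icc d N, s l * (1 / σ * I / t ^ (d - 1)) := by
        refine (Finset.abs_sum_le_sum_abs _ _).trans (Finset.sum_le_sum fun l hl => ?_)
        have hdl := (Finset.mem_Icc.mp hl).1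
        have hpow : t ^ (l - 1) = t ^ (l - d) * t ^ (d - 1) := by
          rw [← pow_add]
          congr 1
          omega
        have hfac : (1 : ℝ) ≤ Nat.factorial (l - d) := by
          exact_mod_cast Nat.factorial_pos (l - d)
        rw [abs_mul, abs_of_nonneg (by positivity)]
        calc t ^ (l - d) / (Nat.factorial (l - d)) * |v l|
            ≤ t ^ (l - d) * (s l / σ * (I / t ^ (l - 1))) :=
              mul_le_mul (div_le_self (by positivity) hfac) (hv l hl) (abs_nonneg _)
                (by positivity)
          _ = s l * (1 / σ * I / t ^ (d - 1)) := by
              rw [hpow]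
              field_simp
    _ = (∑ l ∈ Finset.Icc d N, s l) * (1 / σ * I / t ^ (d - 1)) := by rw [Finset.sum_mul]
    _ ≤ 1 * (1 / σ * I / t ^ (d - 1)) := by
        refine mul_le_mul_of_nonneg_right ?_ (by positivity)
        rw [← hsum]
        exact Finset.sum_le_sum_of_subset_of_nonneg hsub fun l hl _ => hs l hl
    _ = 1 / σ * I / t ^ (d - 1) := one_mul _

/-- For a solution `z ∈ Z_M` of the Hale–Onuchic system, the functions
`y_i(t) = Σ_{l=i}^{r+1} t^{l-i}/(l-i)! z_l(t)` satisfy `|y₁(t) - c| ≤ ψ(t)`,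
`|y_{i+1}(t)| ≤ ψ(t)/t^i` with `ψ(t) = (1/s₀)∫_t^∞ K`, and `y_j' = y_{j+1}`. -/
theorem stmt_3 (k r : ℕ) (hkr : 1 ≤ k + r) (t₀ : ℝ) (ht₀ : 1 ≤ t₀)
    (a : ℕ → ℝ) (c : ℝ) (P : ℝ → (Fin (k + r + 1) → ℝ) → ℝ)
    (hP : ContinuousOn (fun p : ℝ × (Fin (k + r + 1) → ℝ) => P p.1 p.2)
      (Set.Ici t₀ ×ˢ Set.univ))
    (M : ℝ) (hM : 0 < M) (s : ℕ → ℝ) (hs0 : s 0 ∈ Set.Ioo (0 : ℝ) 1)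
    (hsd : ∀ d ∈ Finset.Icc 1 (r + 1), s d ∈ Set.Ico (s 0) 1)
    (hsum : ∑ d ∈ Finset.Icc 1 (r + 1), s d = 1)
    (K : ℝ → ℝ) (hK : ContinuousOn K (Set.Ici t₀)) (hK0 : ∀ t ∈ Set.Ici t₀, 0 ≤ K t)
    (hKint : IntegrableOn K (Set.Ici t₀))
    (hKM : (∫ τ in Set.Ici t₀, K τ) ≤ s 0 * M)
    (hR : ∀ w, ZM t₀ c r s K w →
      ∀ t ∈ Set.Ici t₀, t ^ r * |RHO t₀ k r a P w t| ≤ K t)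
    (z : ℕ → ℝ → ℝ) (hz : ZM t₀ c r s K z)
    (hzsol : ∀ i ∈ Finset.Icc 1 (r + 1), ∀ t ∈ Set.Ici t₀,
      HasDerivAt (z i)
        ((-1 : ℝ) ^ (r + 1 - i) * t ^ (r + 1 - i) / (Nat.factorial (r + 1 - i)) *
          RHO t₀ k r a P z t) t) :
    (∀ t ∈ Set.Ici t₀,
        |SdHO r z 1 t - c| ≤ (1 / s 0) * ∫ τ in Set.Ioi t, K τ) ∧
      (∀ i ∈ Finset.Icc 1 r, ∀ t ∈ Set.Ici t₀,
        |SdHO r z (i + 1) t| ≤ ((1 / s 0) * ∫ τ in Set.Ioi t, K τ) / t ^ i) ∧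
      ∀ j ∈ Finset.Icc 1 r, ∀ t ∈ Set.Ici t₀,
        HasDerivAt (SdHO r z j) (SdHO r z (j + 1) t) t := by
  have hs : ∀ l ∈ Finset.Icc 1 (r + 1), 0 ≤ s l := fun l hl => hs0.1.le.trans (hsd l hl).1
  have hpos : ∀ t ∈ Set.Ici t₀, 0 < t := fun t ht =>
    zero_lt_one.trans_le (ht₀.trans (Set.mem_Ici.mp ht))
  have hKt : ∀ t ∈ Set.Ici t₀, ∀ τ ∈ Set.Ioi t, 0 ≤ K τ := fun t ht τ hτ =>
    hK0 τ ((Set.mem_Ici.mp ht).trans (le_of_lt hτ))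
  have hI : ∀ t ∈ Set.Ici t₀, 0 ≤ ∫ τ in Set.Ioi t, K τ := fun t ht =>
    setIntegral_nonneg measurableSet_Ioi (hKt t ht)
  have hzb : ∀ t ∈ Set.Ici t₀, ∀ l ∈ Finset.Icc 2 (r + 1),
      |z l t| ≤ s l / s 0 * ((∫ τ in Set.Ioi t, K τ) / t ^ (l - 1)) := by
    intro t ht l hl
    have hl1 : l ∈ Finset.Icc 1 (r + 1) := Finset.Icc_subset_Icc_left one_le_two hl
    refine (hz.2.2 l hl t ht).trans (mul_le_mul_of_nonneg_left ?_ (div_nonneg (hs l hl1) hs0.1.le))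
    exact setIntegral_Ioi_div_pow_le (hpos t ht) (hKt t ht)
      (hKint.mono_set (Set.Ioi_subset_Ici ht)) _
  refine ⟨fun t ht => ?_, fun i hi t ht => ?_, fun j hj t ht => ?_⟩
  · have h := sum_Icc_taylor_abs_le (N := r + 1) (d := 1) le_rfl
      (v := fun l => z l t - if l = 1 then c else 0) (hpos t ht) hs0.1 (hI t ht) hs hsum ?_
    · simpa [SdHO, mul_sub, Finset.sum_sub_distrib] using h
    · intro l hl
      by_cases h1 : l = 1
      · subst h1
        simpa using hz.2.1 t ht
      · have hl' := Finset.mem_Icc.mp hl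
        simpa [h1] using hzb t ht l (Finset.mem_Icc.mpr ⟨by omega, hl'.2⟩)
  · have hi' := Finset.mem_Icc.mp hi
    refine sum_Icc_taylor_abs_le (d := i + 1) (v := fun l => z l t) (by omega)
      (hpos t ht) hs0.1 (hI t ht) hs hsum fun l hl => hzb t ht l ?_
    exact Finset.Icc_subset_Icc_left (by omega) hl
  · have hj' := Finset.mem_Icc.mp hj
    exact hasDerivAt_SdHO hj'.2 fun i hi =>
      hzsol i (Finset.Icc_subset_Icc_left hj'.1 hi) t ht
end
end
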